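/- There exist constants c₁, c₂ > 0 and R ∈ ℕ such that for every integer n ≥ 1 there exists a multiple temperature tile system with tile complexity at most c₁, temperature range at most R, and temperature complexity at most c₂ · (log₂ n + 1) that uniquely assembles the n × n square under the multiple tile model. -/

import Mathlib

/-! ## The multiple temperature tile self-assembly model -/

/-- Glues are drawn from a countable alphabet; glue `0` is the distinguished `null` glue. -/
abbrev Glue := ℕ

/-- A tile is a quadruple of glues (north, east, south, west). -/
structure Tile where
  north : Glue
  east : Glue
  south : Glue
  west : Glue
deriving DecidableEq

/-- A configuration maps positions of `ℤ²` to a tile or to `none` (the empty tile). -/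
abbrev Config := ℤ × ℤ → Option Tile

/-- Two abutting edges bond with strength `G x` when they carry the same glue `x`,
and with strength `0` otherwise. -/
def bond (G : Glue → ℕ) (x y : Glue) : ℕ := if x = y then G x else 0

/-- Bonding strength between the edges of tile `t` at position `p` and tile `u`
at (neighboring) position `q`. -/
def edgeBond (G : Glue → ℕ) (t u : Tile) (p q : ℤ × ℤ) : ℕ :=
  if q = (p.1, p.2 + 1) then bond G t.north u.south
  else if q = (p.1 + 1, p.2) then bond G t.east u.west
  else if q = (p.1, p.2 - 1) then bond G t.south u.north
  else if q = (p.1 - 1, p.2) then bond G t.west u.east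
  else 0

/-- The four L¹-neighbors of a position. -/
def neighbors (p : ℤ × ℤ) : List (ℤ × ℤ) :=
  [(p.1, p.2 + 1), (p.1 + 1, p.2), (p.1, p.2 - 1), (p.1 - 1, p.2)]

/-- The shape of a configuration: its set of non-empty positions. -/
def shape (C : Config) : Set (ℤ × ℤ) := {p | C p ≠ none}

/-- Total bonding strength between a tile `t` placed at position `p` and the tiles of `C`
at the four neighboring positions. -/
def attachStrength (G : Glue → ℕ) (C : Config) (t : Tile) (p : ℤ × ℤ) : ℕ :=
  ((neighbors p).map (fun q =>
    match C q with
    | some u => edgeBond G t u p q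
    | none => 0)).sum

/-- Bonding strength between the tiles of `C` at adjacent positions `p` and `q`. -/
def bondAt (G : Glue → ℕ) (C : Config) (p q : ℤ × ℤ) : ℕ :=
  match C p, C q with
  | some t, some u => edgeBond G t u p q
  | _, _ => 0

/-- Total strength of the bonds from `p ∈ Q` leaving the set `Q` in configuration `C`. -/
def outStrength (G : Glue → ℕ) (C : Config) (Q : Finset (ℤ × ℤ)) (p : ℤ × ℤ) : ℕ :=
  (((neighbors p).filter (fun q => q ∉ Q)).map (fun q => bondAt G C p q)).sum

/-- Strength of the cut of (the adjacency graph of) `C` separating `Q` from its complement: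
the sum over crossing edges of the bonding strengths of the corresponding abutting edges. -/
def cutStrength (G : Glue → ℕ) (C : Config) (Q : Finset (ℤ × ℤ)) : ℕ :=
  ∑ p ∈ Q, outStrength G C Q p

/-- The initial configuration: the seed tile `s` at the origin. -/
def seedConfig (s : Tile) : Config := fun p => if p = (0, 0) then some s else none

/-- One step of assembly of the (standard) multiple temperature model at temperature `τ`:
either a tile of `T` attaches at an empty position with total bonding strength at least `τ`,
or the portion `Q` of the supertile on the non-seed side of a cut of strength `< τ`
is removed. -/
inductive Step (T : Finset Tile) (G : Glue → ℕ) (τ : ℕ) : Config → Config → Prop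
  | attach (C : Config) (t : Tile) (p : ℤ × ℤ) :
      t ∈ T → C p = none → τ ≤ attachStrength G C t p →
      Step T G τ C (Function.update C p (some t))
  | detach (C : Config) (Q : Finset (ℤ × ℤ)) :
      Q.Nonempty → ((0, 0) : ℤ × ℤ) ∉ Q → (↑Q : Set (ℤ × ℤ)) ⊆ shape C →
      cutStrength G C Q < τ →
      Step T G τ C (fun q => if q ∈ Q then none else C q)

/-- A configuration is terminal for a step relation if no step applies. -/
def Terminal (step : Config → Config → Prop) (C : Config) : Prop := ∀ D, ¬ step C D

/-- A phase finishes from `C`: there is no infinite sequence of steps starting at `C`. -/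
def PhaseTerminates (step : Config → Config → Prop) (C : Config) : Prop :=
  ¬ ∃ f : ℕ → Config, f 0 = C ∧ ∀ n, step (f n) (f (n + 1))

/-- `MultiReach step τs C E`: starting from `C`, running each phase (one per temperature
in `τs`) to a terminal configuration can produce `E`. -/
inductive MultiReach (step : ℕ → Config → Config → Prop) : List ℕ → Config → Config → Prop
  | nil {C : Config} : MultiReach step [] C C
  | cons {τ : ℕ} {τs : List ℕ} {C D E : Config} :
      Relation.ReflTransGen (step τ) C D → Terminal (step τ) D →
      MultiReach step τs D E → MultiReach step (τ :: τs) C E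

/-- Every phase finishes, no matter which additions and removals are chosen. -/
inductive AllFinish (step : ℕ → Config → Config → Prop) : List ℕ → Config → Prop
  | nil {C : Config} : AllFinish step [] C
  | cons {τ : ℕ} {τs : List ℕ} {C : Config} :
      PhaseTerminates (step τ) C →
      (∀ D, Relation.ReflTransGen (step τ) C D → Terminal (step τ) D → AllFinish step τs D) →
      AllFinish step (τ :: τs) C

/-- The tile system with seed `s` and temperature sequence `τs` uniquely produces the
configuration (supertile) `R`: all phases always finish, and every terminal configuration
produced after the last phase equals `R`. -/
def UniquelyProduces (step : ℕ → Config → Config → Prop) (s : Tile) (τs : List ℕ)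
    (R : Config) : Prop :=
  AllFinish step τs (seedConfig s) ∧
  MultiReach step τs (seedConfig s) R ∧
  ∀ C, MultiReach step τs (seedConfig s) C → C = R

/-- Translation of a set of positions by `d`. -/
def translateSet (d : ℤ × ℤ) (S : Set (ℤ × ℤ)) : Set (ℤ × ℤ) := (fun p => p + d) '' S

/-- The system uniquely assembles the shape `Υ` (up to translation). -/
def UniquelyAssembles (step : ℕ → Config → Config → Prop) (s : Tile) (τs : List ℕ)
    (Υ : Set (ℤ × ℤ)) : Prop :=
  ∃ R : Config, UniquelyProduces step s τs R ∧ ∃ d : ℤ × ℤ, shape R = translateSet d Υ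

/-- The `n × n` square shape `{0,…,n−1} × {0,…,n−1}`. -/
def square (n : ℕ) : Set (ℤ × ℤ) :=
  {p : ℤ × ℤ | 0 ≤ p.1 ∧ p.1 < (n : ℤ) ∧ 0 ≤ p.2 ∧ p.2 < (n : ℤ)}

/-- The `a × b` rectangle shape `{0,…,b−1} × {0,…,a−1}` (`b` columns, `a` rows). -/
def rect (a b : ℕ) : Set (ℤ × ℤ) :=
  {p : ℤ × ℤ | 0 ≤ p.1 ∧ p.1 < (b : ℤ) ∧ 0 ≤ p.2 ∧ p.2 < (a : ℤ)}
/-! ## The multiple tile model -/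

/-- The configuration consisting of the single tile `t` at the origin. -/
def singleTile (t : Tile) : Config := fun p => if p = (0, 0) then some t else none

/-- Translation of a configuration by `d`. -/
def translateConfig (d : ℤ × ℤ) (C : Config) : Config := fun p => C (p - d)

/-- Union of two configurations (with `A` taking priority; intended for disjoint shapes). -/
def unionConfig (A B : Config) : Config := fun p =>
  match A p with
  | some t => some t
  | none => B p

/-- Bonding strength between the tile of `A` at `p` and the tile of `B` at (neighboring) `q`. -/
def crossBond (G : Glue → ℕ) (A B : Config) (p q : ℤ × ℤ) : ℕ :=
  match A p, B q with
  | some t, some u => edgeBond G t u p q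
  | _, _ => 0

/-- Total bonding strength over all abutting edges between configurations `A` and `B`,
where `F` is (the shape of) `A` as a finset. -/
def interStrength (G : Glue → ℕ) (A B : Config) (F : Finset (ℤ × ℤ)) : ℕ :=
  ∑ p ∈ F, ((neighbors p).map (fun q => crossBond G A B p q)).sum

/-- The set `W(T, τ)` of addable supertiles of the multiple tile model: the smallest set
containing each tile of `T` (as a single-tile supertile, anywhere in the plane) and closed
under combining two non-overlapping members whose total abutting bonding strength is
at least `τ`. -/
inductive Addable (T : Finset Tile) (G : Glue → ℕ) (τ : ℕ) : Config → Prop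
  | single {t : Tile} : t ∈ T → Addable T G τ (singleTile t)
  | translate {A : Config} (d : ℤ × ℤ) : Addable T G τ A → Addable T G τ (translateConfig d A)
  | combine {A B : Config} (F : Finset (ℤ × ℤ)) :
      Addable T G τ A → Addable T G τ B →
      (∀ p, A p = none ∨ B p = none) →
      (↑F : Set (ℤ × ℤ)) = shape A →
      τ ≤ interStrength G A B F →
      Addable T G τ (unionConfig A B)

/-- One step of assembly in the multiple tile model at temperature `τ`: either an addable
supertile attaches to the growing seed supertile at a non-overlapping position with total
bonding strength at least `τ`, or the portion of the supertile on the non-seed side of a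
cut of strength `< τ` is removed. -/
inductive MStep (T : Finset Tile) (G : Glue → ℕ) (τ : ℕ) : Config → Config → Prop
  | attach {C A : Config} (F : Finset (ℤ × ℤ)) :
      Addable T G τ A →
      (∀ p, C p = none ∨ A p = none) →
      (↑F : Set (ℤ × ℤ)) = shape A →
      τ ≤ interStrength G A C F →
      MStep T G τ C (unionConfig C A)
  | detach {C : Config} (Q : Finset (ℤ × ℤ)) :
      Q.Nonempty → ((0, 0) : ℤ × ℤ) ∉ Q → (↑Q : Set (ℤ × ℤ)) ⊆ shape C →
      cutStrength G C Q < τ →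
      MStep T G τ C (fun q => if q ∈ Q then none else C q)

namespace TA

inductive Dir | n | e | s | w
deriving DecidableEq

instance : Fintype Dir := ⟨{.n, .e, .s, .w}, by intro x; cases x <;> decide⟩

def op : Dir → Dir
  | .n => .s | .e => .w | .s => .n | .w => .e

def nb : Dir → ℤ × ℤ → ℤ × ℤ
  | .n, p => (p.1, p.2 + 1)
  | .e, p => (p.1 + 1, p.2)
  | .s, p => (p.1, p.2 - 1)
  | .w, p => (p.1 - 1, p.2)

@[simp] lemma op_op (d : Dir) : op (op d) = d := by cases d <;> rfl
@[simp] lemma nb_op (d : Dir) (p : ℤ × ℤ) : nb (op d) (nb d p) = p := by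
  cases d <;> simp [nb, op]
@[simp] lemma nb_op' (d : Dir) (p : ℤ × ℤ) : nb d (nb (op d) p) = p := by
  cases d <;> simp [nb, op]
lemma nb_ne (d : Dir) (p : ℤ × ℤ) : nb d p ≠ p := by
  cases d <;> simp [nb, Prod.ext_iff]
lemma nb_inj {d d' : Dir} {p : ℤ × ℤ} (h : nb d p = nb d' p) : d = d' := by
  cases d <;> cases d' <;> simp [nb] at h ⊢ <;> omega

lemma sum_dir (f : Dir → ℕ) : ∑ d, f d = f .n + f .e + f .s + f .w := by
  have : (Finset.univ : Finset Dir) = {.n, .e, .s, .w} := by decide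
  rw [this]; simp; ring

structure Sys (ι : Type) where
  gl : ι → Dir → ℕ
  G : ℕ → ℕ
  inp : ι → Dir → Bool
  left : ι → Bool

abbrev TC (ι : Type) := ℤ × ℤ → Option ι

variable {ι : Type} (S : Sys ι)

def tl (i : ι) : Tile := ⟨S.gl i .n, S.gl i .e, S.gl i .s, S.gl i .w⟩
def bd (i j : ι) (d : Dir) : ℕ := bond S.G (S.gl i d) (S.gl j (op d))
/-- bond of tile i placed at p with the tile of c in direction d -/
def ob (c : TC ι) (p : ℤ × ℤ) (i : ι) (d : Dir) : ℕ :=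
  match c (nb d p) with
  | some j => bd S i j d
  | none => 0
def xb (a b : TC ι) (p : ℤ × ℤ) (d : Dir) : ℕ :=
  match a p with
  | some i => ob S b p i d
  | none => 0
def toC (c : TC ι) : Config := fun p => (c p).map (tl S)
def un (a b : TC ι) : TC ι := fun p =>
  match a p with
  | some t => some t
  | none => b p

lemma bd_symm (i j : ι) (d : Dir) : bd S i j d = bd S j i (op d) := by
  unfold bd bond
  rw [op_op]
  by_cases h : S.gl i d = S.gl j (op d)
  · simp [h]
  · simp [h, Ne.symm h]

lemma xb_symm (a b : TC ι) (p : ℤ × ℤ) (d : Dir) : xb S a b p d = xb S b a (nb d p) (op d) := by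
  unfold xb ob
  rw [nb_op]
  cases a p <;> cases b (nb d p) <;> simp [bd_symm S _ _ d]

lemma edgeBond_nb (i j : ι) (p : ℤ × ℤ) (d : Dir) :
    edgeBond S.G (tl S i) (tl S j) p (nb d p) = bd S i j d := by
  cases d <;> simp [edgeBond, nb, bd, tl, op, Prod.ext_iff] <;> intros <;> omega

lemma crossBond_nb (a b : TC ι) (p : ℤ × ℤ) (d : Dir) :
    crossBond S.G (toC S a) (toC S b) p (nb d p) = xb S a b p d := by
  unfold crossBond xb ob toC
  cases a p <;> cases b (nb d p) <;> simp [edgeBond_nb]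

lemma neighbors_eq (p : ℤ × ℤ) : neighbors p = [nb .n p, nb .e p, nb .s p, nb .w p] := rfl

lemma inter_eq (a b : TC ι) (F : Finset (ℤ × ℤ)) :
    interStrength S.G (toC S a) (toC S b) F = ∑ p ∈ F, ∑ d, xb S a b p d := by
  unfold interStrength
  refine Finset.sum_congr rfl fun p _ => ?_
  rw [neighbors_eq, sum_dir]
  simp only [List.map, crossBond_nb, List.sum_cons, List.sum_nil]
  ring

lemma bondAt_nb (a : TC ι) (p : ℤ × ℤ) (d : Dir) :
    bondAt S.G (toC S a) p (nb d p) = xb S a a p d := by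
  unfold bondAt xb ob toC
  cases a p <;> cases a (nb d p) <;> simp [edgeBond_nb]

lemma cut_eq (c : TC ι) (Q : Finset (ℤ × ℤ)) :
    cutStrength S.G (toC S c) Q = ∑ p ∈ Q, ∑ d, if nb d p ∈ Q then 0 else xb S c c p d := by
  unfold cutStrength outStrength
  refine Finset.sum_congr rfl fun p _ => ?_
  rw [neighbors_eq, sum_dir]
  simp only [List.filter_cons, List.filter_nil]
  by_cases h1 : nb .n p ∈ Q <;> by_cases h2 : nb .e p ∈ Q <;> by_cases h3 : nb .s p ∈ Q <;>
    by_cases h4 : nb .w p ∈ Q <;> simp [h1, h2, h3, h4, bondAt_nb] <;> ring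

lemma shape_toC (c : TC ι) : shape (toC S c) = {p | c p ≠ none} := by
  ext p; simp [shape, toC]

lemma un_toC (a b : TC ι) : unionConfig (toC S a) (toC S b) = toC S (un a b) := by
  funext p; unfold unionConfig toC un
  cases a p <;> simp

lemma toC_none {c : TC ι} {p : ℤ × ℤ} : toC S c p = none ↔ c p = none := by simp [toC]

lemma inter_symm (a b : TC ι) (F F' : Finset (ℤ × ℤ)) (hF : ∀ p, p ∈ F ↔ a p ≠ none)
    (hF' : ∀ p, p ∈ F' ↔ b p ≠ none) :
    ∑ p ∈ F, ∑ d, xb S a b p d = ∑ p ∈ F', ∑ d, xb S b a p d := by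
  rw [← Finset.sum_product', ← Finset.sum_product']
  refine Finset.sum_bij_ne_zero (fun x _ _ => (nb x.2 x.1, op x.2)) ?_ ?_ ?_ ?_
  · rintro ⟨p, d⟩ h1 h2
    simp only [Finset.mem_product, Finset.mem_univ, and_true, hF'] 
    intro h; apply h2
    simp [xb, ob, h]; cases a p <;> rfl
  · rintro ⟨p, d⟩ _ _ ⟨p', d'⟩ _ _ h
    simp only [Prod.mk.injEq] at h
    have hd : d = d' := by rw [← op_op d, h.2, op_op]
    subst hd
    have := congrArg (nb (op d)) h.1
    simp at this; simp [this]
  · rintro ⟨p, d⟩ h1 h2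
    refine ⟨(nb d p, op d), ?_, ?_, ?_⟩
    · simp only [Finset.mem_product, Finset.mem_univ, and_true, hF] 
      intro h; apply h2
      simp [xb, ob, h]; cases b p <;> rfl
    · simpa [← xb_symm] using h2
    · simp
  · rintro ⟨p, d⟩ _ _
    exact xb_symm S a b p d

def Sat (c : TC ι) (p : ℤ × ℤ) (i : ι) : Prop :=
  ∀ d, S.inp i d = true → ∃ j, c (nb d p) = some j ∧ S.gl j (op d) = S.gl i d
def isum (i : ι) : ℕ := ∑ d, if S.inp i d = true then S.G (S.gl i d) else 0

inductive Gr (τ : ℕ) (c0 : TC ι) : TC ι → Prop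
  | refl : Gr τ c0 c0
  | add {c : TC ι} {p : ℤ × ℤ} {i : ι} : Gr τ c0 c → c p = none → Sat S c p i → τ ≤ isum S i →
      Gr τ c0 (Function.update c p (some i))

variable {S}

lemma Sat.mono {c c' : TC ι} {p : ℤ × ℤ} {i : ι} (h : Sat S c p i)
    (hc : ∀ q j, c q = some j → c' q = some j) : Sat S c' p i := by
  intro d hd
  obtain ⟨j, h1, h2⟩ := h d hd
  exact ⟨j, hc _ _ h1, h2⟩

lemma upd_le {c : TC ι} {p : ℤ × ℤ} (i : ι) (hp : c p = none) :
    ∀ q j, c q = some j → Function.update c p (some i) q = some j := by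
  intro q j h
  have : q ≠ p := by rintro rfl; simp [hp] at h
  simp [this, h]

lemma Gr.le {τ : ℕ} {c0 c : TC ι} (h : Gr S τ c0 c) : ∀ q j, c0 q = some j → c q = some j := by
  induction h with
  | refl => exact fun _ _ h => h
  | add _ hp _ _ ih => exact fun q j h => upd_le _ hp _ _ (ih q j h)

lemma Gr.new {τ : ℕ} {c0 c : TC ι} (h : Gr S τ c0 c) :
    ∀ q j, c q = some j → c0 q = some j ∨ (c0 q = none ∧ Sat S c q j ∧ τ ≤ isum S j) := by
  induction h with
  | refl => exact fun _ _ h => Or.inl h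
  | @add c p i h hp hs ht ih =>
    intro q j hq
    by_cases hqp : q = p
    · subst hqp
      simp at hq; subst hq
      right
      refine ⟨?_, hs.mono (upd_le _ hp), ht⟩
      by_contra hne
      obtain ⟨k, hk⟩ := Option.ne_none_iff_exists'.1 hne
      rw [h.le _ _ hk] at hp; cases hp
    · simp [hqp] at hq
      rcases ih q j hq with h | ⟨h0, h1, h2⟩
      · exact Or.inl h
      · exact Or.inr ⟨h0, h1.mono (upd_le _ hp), h2⟩

lemma Gr.trans {τ : ℕ} {c0 c c' : TC ι} (h : Gr S τ c0 c) (h' : Gr S τ c c') : Gr S τ c0 c' := by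
  induction h' with
  | refl => exact h
  | add _ hp hs ht ih => exact Gr.add ih hp hs ht

lemma Gr.union {τ : ℕ} {c0 c b : TC ι} (h : Gr S τ c0 c) (hd : ∀ p, b p = none ∨ c p = none) :
    Gr S τ (un b c0) (un b c) := by
  induction h with
  | refl => exact Gr.refl
  | @add c p i h hp hs ht ih =>
    have hbp : b p = none := by
      rcases hd p with h | h
      · exact h
      · simp at h
    have e : un b (Function.update c p (some i)) = Function.update (un b c) p (some i) := by
      funext q
      by_cases hq : q = p
      · subst hq; simp [un, hbp]
      · simp [un, hq]
    rw [e]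
    have hd' : ∀ q, b q = none ∨ c q = none := by
      intro q
      rcases hd q with h | h
      · exact Or.inl h
      · right
        by_cases hq : q = p
        · subst hq; exact hp
        · simpa [hq] using h
    refine Gr.add (ih hd') (by simp [un, hbp, hp]) ?_ ht
    refine hs.mono ?_
    intro q j hq
    rcases hd' q with h | h
    · simp [un, h, hq]
    · rw [h] at hq; cases hq

lemma Gr.fin {τ : ℕ} {c0 c : TC ι} (h : Gr S τ c0 c) (h0 : {p | c0 p ≠ none}.Finite) :
    {p | c p ≠ none}.Finite := by
  induction h with
  | refl => exact h0
  | @add c p i h hp hs ht ih =>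
    refine (ih.insert p).subset ?_
    intro q hq
    by_cases h : q = p
    · simp [h]
    · right; simpa [h] using hq

lemma Gr.translate {τ : ℕ} {c0 c : TC ι} (h : Gr S τ c0 c) (v : ℤ × ℤ) :
    Gr S τ (fun p => c0 (p - v)) (fun p => c (p - v)) := by
  induction h with
  | refl => exact Gr.refl
  | @add c p i h hp hs ht ih =>
    have e : (fun q => Function.update c p (some i) (q - v)) =
        Function.update (fun q => c (q - v)) (p + v) (some i) := by
      funext q
      by_cases hq : q = p + v
      · subst hq; simp
      · have : q - v ≠ p := fun h => hq (by rw [← h]; simp)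
        simp [hq, this]
    rw [e]
    refine Gr.add ih (by simp [hp]) ?_ ht
    intro d hd
    obtain ⟨j, h1, h2⟩ := hs d hd
    refine ⟨j, ?_, h2⟩
    have e2 : nb d (p + v) - v = nb d p := by
      cases d <;> refine Prod.ext ?_ ?_ <;> simp [nb] <;> ring
    simp only [e2, h1]

def single (r : ℤ × ℤ) (i : ι) : TC ι := fun p => if p = r then some i else none

variable (S) in
structure Good (lo : ℕ) : Prop where
  G0 : S.G 0 = 0
  A1 : ∀ i j d, 0 < bd S i j d → S.inp i d = true ∨ S.inp j (op d) = true
  A2 : ∀ i d0, S.inp i d0 = true →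
    (∑ d, if S.inp i d = true ∧ d ≠ d0 then S.G (S.gl i d) else 0) < lo
  A3 : ∀ i d, S.left i = true → S.inp i d = true → d = .e ∨ d = .n
  A3e : ∀ i d, S.left i = true → S.inp i d = true → S.inp i .e = true
  A3' : ∀ i, S.left i = false → S.inp i .e = false
  A4 : ∀ i j d, S.inp i d = true → S.gl j (op d) = S.gl i d → S.left j = true → S.left i = true
  A5 : ∀ i j d, S.inp i d = true → S.inp j (op d) = true → bd S i j d < lo

lemma exists_inp {i : ι} {τ : ℕ} (h : τ ≤ isum S i) (h1 : 1 ≤ τ) : ∃ d, S.inp i d = true := by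
  by_contra hc
  push Not at hc
  have : isum S i = 0 := by
    unfold isum
    refine Finset.sum_eq_zero fun d _ => ?_
    rw [if_neg (hc d)]
  omega

lemma bd_le (i j : ι) (d : Dir) : bd S i j d ≤ S.G (S.gl i d) := by
  unfold bd bond; split_ifs <;> simp

lemma bd_pos {i j : ι} {d : Dir} (h : 0 < bd S i j d) :
    S.gl j (op d) = S.gl i d ∧ bd S i j d = S.G (S.gl i d) := by
  unfold bd bond at *
  split_ifs at h with h1
  · simp [h1]
  · omega

/-- left-rooted floats -/
lemma Gr.leftRoot {lo τ : ℕ} (g : Good S lo) (h1 : 1 ≤ τ) {r : ℤ × ℤ} {i0 : ι} {a : TC ι}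
    (h : Gr S τ (single r i0) a) (hl : S.left i0 = true) :
    ∀ q j, a q = some j → S.left j = true ∧ (q = r ∨ q.1 < r.1) := by
  induction h with
  | refl =>
    intro q j h
    unfold single at h
    split_ifs at h with hq
    cases h; exact ⟨hl, Or.inl hq⟩
  | @add c p i h hp hs ht ih =>
    intro q j hq
    by_cases hqp : q = p
    · subst hqp
      simp at hq; subst hq
      obtain ⟨d, hd⟩ := exists_inp ht h1
      obtain ⟨j, hj1, hj2⟩ := hs d hd
      have hli := g.A4 _ _ _ hd hj2 (ih _ _ hj1).1
      refine ⟨hli, Or.inr ?_⟩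
      obtain ⟨j', hj1', hj2'⟩ := hs .e (g.A3e _ _ hli hd)
      rcases (ih _ _ hj1').2 with h | h
      · rw [← h]; simp [nb]
      · simp [nb] at h; omega
    · simp [hqp] at hq
      exact ih q j hq

lemma Gr.rightRoot {lo τ : ℕ} (g : Good S lo) (h1 : 1 ≤ τ) {r : ℤ × ℤ} {i0 : ι} {a : TC ι}
    (h : Gr S τ (single r i0) a) :
    ∀ q j, a q = some j → S.left j = false → r.1 ≤ q.1 ∧
      (q.1 = r.1 → ∀ y, (q.2 ≤ y ∧ y ≤ r.2 ∨ r.2 ≤ y ∧ y ≤ q.2) → a (r.1, y) ≠ none) := by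
  induction h with
  | refl =>
    intro q j h _
    unfold single at h
    split_ifs at h with hq
    subst hq
    refine ⟨le_refl _, fun _ y hy => ?_⟩
    have : y = q.2 := by omega
    subst this
    simp [single]
  | @add c p i h hp hs ht ih =>
    intro q j hq hlj
    have mono : ∀ z, c z ≠ none → Function.update c p (some i) z ≠ none := by
      intro z hz
      by_cases hzp : z = p
      · subst hzp; simp
      · simpa [hzp] using hz
    by_cases hqp : q = p
    · subst hqp
      simp at hq; subst hq
      obtain ⟨d, hd⟩ := exists_inp ht h1
      obtain ⟨k, hk1, hk2⟩ := hs d hd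
      have hlk : S.left k = false := by
        by_contra hne
        have := g.A4 _ _ _ hd hk2 (by simpa using hne)
        simp [this] at hlj
      obtain ⟨ih1, ih2⟩ := ih _ _ hk1 hlk
      have hself : ∀ y, q.1 = r.1 → y = q.2 → Function.update c q (some i) (r.1, y) ≠ none := by
        intro y h1 h2
        have : (r.1, y) = q := by rw [h2, ← h1]
        rw [this]; simp
      cases d with
      | e => have := g.A3' _ hlj; simp [this] at hd
      | w => simp [nb] at ih1 ih2; exact ⟨by omega, fun h => by omega⟩
      | n =>
        simp only [nb] at ih1 ih2
        refine ⟨ih1, fun hx y hy => ?_⟩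
        by_cases hy2 : y = q.2
        · exact hself y hx hy2
        · exact mono _ (ih2 hx y (by omega))
      | s =>
        simp only [nb] at ih1 ih2
        refine ⟨ih1, fun hx y hy => ?_⟩
        by_cases hy2 : y = q.2
        · exact hself y hx hy2
        · exact mono _ (ih2 hx y (by omega))
    · simp [hqp] at hq
      obtain ⟨ih1, ih2⟩ := ih q j hq hlj
      exact ⟨ih1, fun hx y hy => mono _ (ih2 hx y hy)⟩

end TA

namespace TA
variable {ι : Type} {S : Sys ι}

lemma sat_of_ob {lo τ : ℕ} (g : Good S lo) (hlo : lo ≤ τ) {c : TC ι} {p : ℤ × ℤ} {i : ι}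
    (h : ∀ d, 0 < ob S c p i d → S.inp i d = true) (ht : τ ≤ ∑ d, ob S c p i d) :
    Sat S c p i ∧ τ ≤ isum S i := by
  have hle : ∀ d, ob S c p i d ≤ if S.inp i d = true then S.G (S.gl i d) else 0 := by
    intro d
    by_cases hd : S.inp i d = true
    · rw [if_pos hd]
      unfold ob
      cases c (nb d p) with
      | none => simp
      | some j => exact bd_le _ _ _
    · rw [if_neg hd]
      by_contra hne
      exact hd (h d (by omega))
  refine ⟨?_, ht.trans (Finset.sum_le_sum fun d _ => hle d)⟩
  intro d0 hd0
  by_contra hne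
  have h0 : ob S c p i d0 = 0 := by
    by_contra h0
    apply hne
    unfold ob at h0
    cases hc : c (nb d0 p) with
    | none => simp [hc] at h0
    | some j =>
      simp only [hc] at h0
      exact ⟨j, rfl, (bd_pos (Nat.pos_of_ne_zero h0)).1⟩
  have := g.A2 i d0 hd0
  have h2 : ∑ d, ob S c p i d ≤
      ∑ d, if S.inp i d = true ∧ d ≠ d0 then S.G (S.gl i d) else 0 := by
    refine Finset.sum_le_sum fun d _ => ?_
    by_cases hd : d = d0
    · subst hd; simp [h0]
    · have := hle d
      simpa [hd] using this
  omega

lemma xb_pos {a b : TC ι} {p : ℤ × ℤ} {d : Dir} (h : 0 < xb S a b p d) :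
    ∃ i j, a p = some i ∧ b (nb d p) = some j ∧ 0 < bd S i j d := by
  unfold xb ob at h
  cases ha : a p <;> cases hb : b (nb d p) <;> simp [ha, hb] at h
  exact ⟨_, _, rfl, rfl, h⟩

lemma root_of_inp {τ : ℕ} {r : ℤ × ℤ} {i0 : ι} {a b : TC ι} (h : Gr S τ (single r i0) a)
    (hd : ∀ p, a p = none ∨ b p = none) {p : ℤ × ℤ} {d : Dir} {i j : ι} (hi : a p = some i)
    (hj : b (nb d p) = some j) (hin : S.inp i d = true) : p = r ∧ i = i0 := by
  rcases h.new p i hi with h1 | ⟨_, h1, _⟩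
  · unfold single at h1
    split_ifs at h1 with hp
    cases h1; exact ⟨hp, rfl⟩
  · obtain ⟨k, hk, _⟩ := h1 d hin
    rcases hd (nb d p) with h2 | h2
    · rw [h2] at hk; cases hk
    · rw [h2] at hj; cases hj

lemma Gr.root {τ : ℕ} {r : ℤ × ℤ} {i0 : ι} {a : TC ι} (h : Gr S τ (single r i0) a) :
    a r = some i0 := h.le _ _ (by simp [single])

lemma un_comm {a b : TC ι} (hd : ∀ p, a p = none ∨ b p = none) : un a b = un b a := by
  funext p
  rcases hd p with h | h
  · unfold un; rw [h]; cases b p <;> rfl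
  · unfold un; rw [h]; cases a p <;> rfl

lemma joinGr {τ : ℕ} {r : ℤ × ℤ} {i0 : ι} {a b : TC ι} (h : Gr S τ (single r i0) a)
    (hd : ∀ p, b p = none ∨ a p = none) (hs : Sat S b r i0) (ht : τ ≤ isum S i0) :
    Gr S τ b (un b a) := by
  have hb : b r = none := by
    rcases hd r with h1 | h1
    · exact h1
    · rw [h.root] at h1; cases h1
  have e : un b (single r i0) = Function.update b r (some i0) := by
    funext q
    by_cases hq : q = r
    · subst hq; simp [un, hb, single]
    · unfold un single
      simp [hq]; cases b q <;> rfl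
  have := h.union hd
  rw [e] at this
  exact (Gr.add Gr.refl hb hs ht).trans this

lemma sum_at_root {a b : TC ι} {F : Finset (ℤ × ℤ)} {r : ℤ × ℤ} {i0 : ι} (hr : a r = some i0)
    (h : ∀ p d, 0 < xb S a b p d → p = r) :
    ∑ p ∈ F, ∑ d, xb S a b p d ≤ ∑ d, ob S b r i0 d := by
  have hle : ∀ d, xb S a b r d = ob S b r i0 d := by intro d; simp [xb, hr]
  simp only [← hle]
  by_cases hF : r ∈ F
  · rw [Finset.sum_eq_single_of_mem r hF]
    intro p _ hp
    refine Finset.sum_eq_zero fun d _ => ?_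
    by_contra hne
    exact hp (h p d (Nat.pos_of_ne_zero hne))
  · rw [Finset.sum_eq_zero]
    · simp
    intro p hp
    refine Finset.sum_eq_zero fun d _ => ?_
    by_contra hne
    have := h p d (Nat.pos_of_ne_zero hne)
    subst this
    exact hF hp

lemma ob_pos {c : TC ι} {p : ℤ × ℤ} {i : ι} {d : Dir} (h : 0 < ob S c p i d) :
    ∃ j, c (nb d p) = some j ∧ 0 < bd S i j d := by
  unfold ob at h
  cases hc : c (nb d p) with
  | none => simp [hc] at h
  | some j => exact ⟨j, rfl, by simpa [hc] using h⟩

/-- if every positive edge is an input edge of the root of `a`, then `a` grows on `b`. -/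
lemma combine_one {lo τ : ℕ} (g : Good S lo) (hlo : lo ≤ τ) {r : ℤ × ℤ} {i0 : ι} {a b : TC ι}
    {F : Finset (ℤ × ℤ)}
    (h : Gr S τ (single r i0) a) (hd : ∀ p, b p = none ∨ a p = none)
    (ht : τ ≤ ∑ p ∈ F, ∑ d, xb S a b p d)
    (hk : ∀ p d, 0 < xb S a b p d → p = r ∧ S.inp i0 d = true) :
    Gr S τ b (un b a) := by
  have h1 := sum_at_root (S := S) (b := b) (F := F) h.root (fun p d hp => (hk p d hp).1)
  obtain ⟨h2, h3⟩ := sat_of_ob g hlo (c := b) (p := r) (i := i0) (fun d hdd =>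
    (hk r d (by simpa [xb, h.root] using hdd)).2) (ht.trans h1)
  exact joinGr h hd h2 h3

lemma both_kinds {lo τ : ℕ} (g : Good S lo) (h1 : 1 ≤ τ)
    {r r' : ℤ × ℤ} {i0 i0' : ι} {a b : TC ι}
    (h : Gr S τ (single r i0) a) (h' : Gr S τ (single r' i0') b)
    (hd : ∀ p, a p = none ∨ b p = none)
    {d d' : Dir} {j j' : ι} (hj : b (nb d r) = some j) (hi : S.inp i0 d = true)
    (hg : S.gl j (op d) = S.gl i0 d)
    (hj' : a (nb d' r') = some j') (hi' : S.inp i0' d' = true)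
    (hg' : S.gl j' (op d') = S.gl i0' d') : nb d r = r' := by
  have hne : r ≠ r' := by
    rintro rfl
    rcases hd r with h2 | h2
    · rw [h.root] at h2; cases h2
    · rw [h'.root] at h2; cases h2
  cases hl : S.left i0 with
  | true =>
    have L1 := h.leftRoot g h1 hl
    have hl' : S.left i0' = true := g.A4 _ _ _ hi' hg' (L1 _ _ hj').1
    have L2 := h'.leftRoot g h1 hl'
    have e1 := (L2 _ _ hj).2
    have e2 := (L1 _ _ hj').2
    exfalso
    rcases g.A3 _ _ hl hi with rfl | rfl <;> rcases g.A3 _ _ hl' hi' with rfl | rfl <;>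
      simp [nb, Prod.ext_iff] at e1 e2 hne <;> omega
  | false =>
    have hlj' : S.left j = false := by
      by_contra hc
      have := g.A4 _ _ _ hi hg (by simpa using hc)
      simp [this] at hl
    have hl' : S.left i0' = false := by
      by_contra hc
      have := (h'.leftRoot g h1 (by simpa using hc) _ _ hj).1
      simp [this] at hlj'
    have hlj : S.left j' = false := by
      by_contra hc
      have := g.A4 _ _ _ hi' hg' (by simpa using hc)
      simp [this] at hl'
    obtain ⟨x1, c1⟩ := h'.rightRoot g h1 _ _ hj hlj'
    obtain ⟨x2, c2⟩ := h.rightRoot g h1 _ _ hj' hlj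
    have e1 := g.A3' _ hl
    have e2 := g.A3' _ hl'
    have key : ∀ x y, (r.1 = x ∧ r.2 = y) → b (x, y) = none := by
      rintro x y ⟨rfl, rfl⟩
      rcases hd r with h2 | h2
      · rw [h.root] at h2; cases h2
      · exact h2
    have key' : ∀ x y, (r'.1 = x ∧ r'.2 = y) → a (x, y) = none := by
      rintro x y ⟨rfl, rfl⟩
      rcases hd r' with h2 | h2
      · exact h2
      · rw [h'.root] at h2; cases h2
    have u1 : (nb d r).1 ≤ r.1 := by
      cases d <;> simp [nb]
      rw [e1] at hi; cases hi
    have u2 : (nb d' r').1 ≤ r'.1 := by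
      cases d' <;> simp [nb]
      rw [e2] at hi'; cases hi'
    have hxx : r.1 = r'.1 := by omega
    have hyy : r.2 ≠ r'.2 := fun hy => hne (Prod.ext hxx hy)
    have hdw : d ≠ .w := by rintro rfl; simp [nb] at x1; omega
    have hdw' : d' ≠ .w := by rintro rfl; simp [nb] at x2; omega
    have hb : ∀ y, (nb d r).2 ≤ y ∧ y ≤ r'.2 ∨ r'.2 ≤ y ∧ y ≤ (nb d r).2 → b (r'.1, y) ≠ none :=
      fun y => c1 (by omega) y
    have ha : ∀ y, (nb d' r').2 ≤ y ∧ y ≤ r.2 ∨ r.2 ≤ y ∧ y ≤ (nb d' r').2 → a (r.1, y) ≠ none :=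
      fun y => c2 (by omega) y
    have hnr : ¬ ((nb d r).2 ≤ r.2 ∧ r.2 ≤ r'.2 ∨ r'.2 ≤ r.2 ∧ r.2 ≤ (nb d r).2) :=
      fun hh => hb r.2 hh (key _ _ ⟨hxx, rfl⟩)
    have hnr' : ¬ ((nb d' r').2 ≤ r'.2 ∧ r'.2 ≤ r.2 ∨ r.2 ≤ r'.2 ∧ r'.2 ≤ (nb d' r').2) :=
      fun hh => ha r'.2 hh (key' _ _ ⟨hxx.symm, rfl⟩)
    have hcom : ∀ y, ¬ (((nb d r).2 ≤ y ∧ y ≤ r'.2 ∨ r'.2 ≤ y ∧ y ≤ (nb d r).2) ∧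
        ((nb d' r').2 ≤ y ∧ y ≤ r.2 ∨ r.2 ≤ y ∧ y ≤ (nb d' r').2)) := by
      rintro y ⟨q1, q2⟩
      have := hb y q1
      have := ha y q2
      rcases hd (r.1, y) with h3 | h3
      · exact this h3
      · rw [hxx] at h3; exact hb y q1 h3
    refine Prod.ext ?_ ?_
    · omega
    · have hc := hcom (nb d r).2
      have v1 : (nb d r).2 = r.2 + 1 ∨ (nb d r).2 = r.2 - 1 := by
        cases d
        · left; rfl
        · rw [e1] at hi; cases hi
        · right; rfl
        · exact absurd rfl hdw
      have v2 : (nb d' r').2 = r'.2 + 1 ∨ (nb d' r').2 = r'.2 - 1 := by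
        cases d'
        · left; rfl
        · rw [e2] at hi'; cases hi'
        · right; rfl
        · exact absurd rfl hdw'
      clear hcom hb ha c1 c2
      omega

lemma combine_fl {lo τ : ℕ} (g : Good S lo) (hlo : lo ≤ τ) (h1 : 1 ≤ τ)
    {r r' : ℤ × ℤ} {i0 i0' : ι} {a b : TC ι} {F : Finset (ℤ × ℤ)}
    (h : Gr S τ (single r i0) a) (h' : Gr S τ (single r' i0') b)
    (hd : ∀ p, a p = none ∨ b p = none) (hF : ∀ p, p ∈ F ↔ a p ≠ none)
    (ht : τ ≤ ∑ p ∈ F, ∑ d, xb S a b p d) :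
    ∃ r i, Gr S τ (single r i) (un a b) := by
  by_cases k1 : ∀ p d, 0 < xb S a b p d → p = r ∧ S.inp i0 d = true
  · have := combine_one g hlo h (fun p => (hd p).symm) ht k1
    rw [un_comm hd]
    exact ⟨r', i0', h'.trans this⟩
  by_cases k2 : ∀ p d, 0 < xb S b a p d → p = r' ∧ S.inp i0' d = true
  · have hfin : {p | b p ≠ none}.Finite := h'.fin ((Set.finite_singleton r').subset (by
      intro q hq; by_contra hne; apply hq; simp [single] at *; exact hne))
    have e := inter_symm S a b F hfin.toFinset hF (by simp)
    rw [e] at ht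
    exact ⟨r, i0, h.trans (combine_one g hlo h' hd ht k2)⟩
  exfalso
  push Not at k1 k2
  -- classification of edges
  have cls : ∀ p d, 0 < xb S a b p d → (p = r ∧ S.inp i0 d = true) ∨
      (nb d p = r' ∧ S.inp i0' (op d) = true) := by
    intro p d hp
    obtain ⟨i, j, hi, hj, hb⟩ := xb_pos hp
    rcases g.A1 _ _ _ hb with h2 | h2
    · obtain ⟨e1, e2⟩ := root_of_inp h hd hi hj h2
      exact Or.inl ⟨e1, e2 ▸ h2⟩
    · obtain ⟨e1, e2⟩ := root_of_inp (d := op d) h' (fun p => (hd p).symm) hj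
        (by simpa using hi) h2
      exact Or.inr ⟨e1, e2 ▸ h2⟩
  obtain ⟨p1, d1, hp1, hn1⟩ := k1
  obtain ⟨p2, d2, hp2, hn2⟩ := k2
  rw [xb_symm] at hp2
  have q1 : nb d1 p1 = r' ∧ S.inp i0' (op d1) = true := by
    rcases cls _ _ hp1 with h2 | h2
    · exact absurd h2.2 (hn1 h2.1)
    · exact h2
  have q2 : nb d2 p2 = r ∧ S.inp i0 (op d2) = true := by
    rcases cls _ _ hp2 with h2 | h2
    · exact h2
    · simp at h2; exact absurd h2.2 (hn2 h2.1)
  have E1 : ∃ d' j', a (nb d' r') = some j' ∧ S.inp i0' d' = true ∧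
      S.gl j' (op d') = S.gl i0' d' := by
    obtain ⟨i, j, hi, hj, hb⟩ := xb_pos hp1
    refine ⟨op d1, i, ?_, q1.2, ?_⟩
    · rw [← q1.1]; simpa using hi
    · rw [q1.1, h'.root] at hj; cases hj
      simpa using (bd_pos hb).1.symm
  have E2 : ∃ d j, b (nb d r) = some j ∧ S.inp i0 d = true ∧ S.gl j (op d) = S.gl i0 d := by
    obtain ⟨i, j, hi, hj, hb⟩ := xb_pos hp2
    refine ⟨op d2, j, ?_, q2.2, ?_⟩
    · rw [← q2.1]; exact hj
    · rw [q2.1, h.root] at hi; cases hi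
      exact (bd_pos hb).1
  obtain ⟨d', j', w1, w2, w3⟩ := E1
  obtain ⟨d, j, v1, v2, v3⟩ := E2
  have er' := both_kinds g h1 h h' hd v1 v2 v3 w1 w2 w3
  have er := both_kinds g h1 h' h (fun p => (hd p).symm) w1 w2 w3 v1 v2 v3
  have hroot : ∀ p dd, 0 < xb S a b p dd → p = r ∧ dd = d := by
    intro p dd hp
    obtain ⟨i, k, hi, hk, hb⟩ := xb_pos hp
    rcases cls p dd hp with ⟨rfl, c2⟩ | ⟨c1, c2⟩
    · rw [h.root] at hi; cases hi
      have := both_kinds g h1 h h' hd hk c2 (bd_pos hb).1 w1 w2 w3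
      exact ⟨rfl, nb_inj (this.trans er'.symm)⟩
    · have hk' : k = i0' := by rw [c1, h'.root] at hk; cases hk; rfl
      subst hk'
      have := both_kinds g h1 h' h (fun p => (hd p).symm) (d := op dd) (j := i)
        (by rw [← c1]; simpa using hi) c2 (by simpa using (bd_pos hb).1.symm) v1 v2 v3
      have hp : p = r := by rw [← this, ← c1]; simp
      subst hp
      exact ⟨rfl, nb_inj (c1.trans er'.symm)⟩
  have hs := sum_at_root (S := S) (b := b) (F := F) h.root (fun p d hp => (hroot p d hp).1)
  have hs2 : ∑ dd, ob S b r i0 dd = ob S b r i0 d := by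
    refine Finset.sum_eq_single_of_mem d (Finset.mem_univ _) ?_
    intro dd _ hne
    by_contra h0
    exact hne (hroot r dd (by simpa [xb, h.root] using Nat.pos_of_ne_zero h0)).2
  have hd'd : d' = op d := by
    have : nb d' r' = nb (op d) r' := by rw [er, ← er']; simp
    exact nb_inj this
  have hfin : ob S b r i0 d < lo := by
    unfold ob
    rw [er', h'.root]
    exact g.A5 _ _ _ v2 (hd'd ▸ w2)
  omega

lemma addable_fl [Fintype ι] {lo τ : ℕ} (g : Good S lo) (hlo : lo ≤ τ) (h1 : 1 ≤ τ) {A : Config}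
    (hA : Addable (Finset.univ.image (tl S)) S.G τ A) :
    ∃ a r i, A = toC S a ∧ Gr S τ (single r i) a := by
  induction hA with
  | @single t ht =>
    simp only [Finset.mem_image, Finset.mem_univ, true_and] at ht
    obtain ⟨i, rfl⟩ := ht
    refine ⟨single (0, 0) i, (0, 0), i, ?_, Gr.refl⟩
    funext p; unfold singleTile toC single
    split_ifs <;> rfl
  | @translate A v _ ih =>
    obtain ⟨a, r, i, rfl, h⟩ := ih
    refine ⟨fun p => a (p - v), r + v, i, rfl, ?_⟩
    have := h.translate v
    convert this using 2
    unfold single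
    simp [sub_eq_iff_eq_add]
  | @combine A B F _ _ hd hF ht ihA ihB =>
    obtain ⟨a, r, i, rfl, h⟩ := ihA
    obtain ⟨b, r', i', rfl, h'⟩ := ihB
    rw [inter_eq] at ht
    simp only [toC_none] at hd
    have hF' : ∀ p, p ∈ F ↔ a p ≠ none := by
      intro p
      rw [← Finset.mem_coe, hF, shape_toC]; rfl
    obtain ⟨r2, i2, h2⟩ := combine_fl g hlo h1 h h' hd hF' ht
    exact ⟨un a b, r2, i2, un_toC S a b, h2⟩

end TA

namespace TA
variable {ι : Type} {S : Sys ι}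

def Le (c D : TC ι) : Prop := ∀ q j, c q = some j → D q = some j

lemma Le.nn {c D : TC ι} (h : Le c D) {q : ℤ × ℤ} (hq : D q = none) : c q = none := by
  cases hc : c q with
  | none => rfl
  | some j => rw [h _ _ hc] at hq; cases hq

lemma Le.antisymm {c D : TC ι} (h : Le c D) (h' : ∀ p, c p = none → D p = none) : c = D := by
  funext p
  cases hc : c p with
  | none => exact (h' p hc).symm
  | some j => exact (h _ _ hc).symm

variable (S) in
def QX (τ : ℕ) (c : TC ι) : Prop :=
  ∀ q j d i, c q = some j → S.inp j d = true → c (nb d q) = none → 0 < bd S j i d →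
    S.inp i (op d) = true ∨ (¬ τ ≤ isum S i ∧ ∀ p, ∑ d', ob S c p i d' < τ)

lemma attach_gr {lo τ : ℕ} (g : Good S lo) (hlo : lo ≤ τ) {r : ℤ × ℤ} {i0 : ι} {a c : TC ι}
    {F : Finset (ℤ × ℤ)}
    (h : Gr S τ (single r i0) a) (hd : ∀ p, c p = none ∨ a p = none)
    (ht : τ ≤ ∑ p ∈ F, ∑ d, xb S a c p d) (hq : QX S τ c) : Gr S τ c (un c a) := by
  have cls : ∀ p d, 0 < xb S a c p d → p = r ∧ (S.inp i0 d = true ∨ ∑ d', ob S c r i0 d' < τ) := by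
    intro p d hp
    obtain ⟨i, j, hi, hj, hb⟩ := xb_pos hp
    have in1 : S.inp i d = true → p = r ∧ (S.inp i0 d = true ∨ ∑ d', ob S c r i0 d' < τ) := by
      intro h2
      obtain ⟨e1, e2⟩ := root_of_inp h (fun p => (hd p).symm) hi hj h2
      exact ⟨e1, Or.inl (e2 ▸ h2)⟩
    rcases g.A1 _ _ _ hb with h2 | h2
    · exact in1 h2
    · have hcp : c (nb (op d) (nb d p)) = none := by
        rw [nb_op]
        rcases hd p with h3 | h3
        · exact h3
        · rw [h3] at hi; cases hi
      rcases hq _ _ _ i hj h2 hcp (by rw [bd_symm, op_op]; exact hb) with h3 | ⟨h3, h4⟩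
      · rw [op_op] at h3; exact in1 h3
      · rcases h.new _ _ hi with h5 | ⟨_, _, h5⟩
        · unfold single at h5
          split_ifs at h5 with hpr
          cases h5
          exact ⟨hpr, Or.inr (h4 r)⟩
        · exact absurd h5 h3
  have hs := sum_at_root (S := S) (b := c) (F := F) h.root (fun p d hp => (cls p d hp).1)
  refine combine_one g hlo h hd ht fun p d hp => ?_
  rcases cls p d hp with ⟨h1, h2 | h2⟩
  · exact ⟨h1, h2⟩
  · omega

variable (S) in
def cutT (c : TC ι) (Q : Finset (ℤ × ℤ)) : ℕ :=
  ∑ p ∈ Q, ∑ d, if nb d p ∈ Q then 0 else xb S c c p d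

lemma ob_mono {c c' : TC ι} (h : Le c c') (p : ℤ × ℤ) (i : ι) (d : Dir) :
    ob S c p i d ≤ ob S c' p i d := by
  unfold ob
  cases hc : c (nb d p) with
  | none => simp
  | some j => rw [h _ _ hc]

lemma xb_mono {c c' : TC ι} (h : Le c c') (p : ℤ × ℤ) (d : Dir) :
    xb S c c p d ≤ xb S c' c' p d := by
  unfold xb
  cases hc : c p with
  | none => simp
  | some j => rw [h _ _ hc]; exact ob_mono h _ _ _

lemma xb_none_right {a b : TC ι} {p : ℤ × ℤ} {d : Dir} (h : b (nb d p) = none) :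
    xb S a b p d = 0 := by
  unfold xb ob; rw [h]; cases a p <;> rfl

lemma cut_mono {c c' : TC ι} (h : Le c c') {Q' Q : Finset (ℤ × ℤ)} (hQ : Q' ⊆ Q)
    (hn : ∀ p ∈ Q, p ∉ Q' → c p = none) : cutT S c Q' ≤ cutT S c' Q := by
  unfold cutT
  refine (Finset.sum_le_sum fun p hp => Finset.sum_le_sum fun d _ => ?_).trans
    (Finset.sum_le_sum_of_subset hQ)
  by_cases h1 : nb d p ∈ Q'
  · simp [h1]
  · by_cases h2 : nb d p ∈ Q
    · simp [h1, h2, xb_none_right (S := S) (a := c) (hn _ h2 h1)]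
    · simp [h1, h2, xb_mono h]

variable (S) in
def Stable (τ : ℕ) (c : TC ι) : Prop :=
  ∀ Q : Finset (ℤ × ℤ), Q.Nonempty → ((0, 0) : ℤ × ℤ) ∉ Q → (∀ p ∈ Q, c p ≠ none) → τ ≤ cutT S c Q

lemma Sat.sum {c : TC ι} {p : ℤ × ℤ} {i : ι} (h : Sat S c p i) : isum S i ≤ ∑ d, ob S c p i d := by
  refine Finset.sum_le_sum fun d _ => ?_
  split_ifs with hd
  · obtain ⟨j, h1, h2⟩ := h d hd
    simp [ob, h1, bd, bond, h2]
  · simp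

lemma cut_single {c : TC ι} {p : ℤ × ℤ} {i : ι} (h : c p = some i) :
    cutT S c {p} = ∑ d, ob S c p i d := by
  unfold cutT
  rw [Finset.sum_singleton]
  refine Finset.sum_congr rfl fun d _ => ?_
  rw [if_neg (by simpa using nb_ne d p)]
  simp [xb, h]

lemma Stable.gr {τ : ℕ} {c0 c : TC ι} (hs : Stable S τ c0) (h : Gr S τ c0 c) : Stable S τ c := by
  induction h with
  | refl => exact hs
  | @add c p i h hp hsat ht ih =>
    intro Q hne h0 hQ
    have hle : Le c (Function.update c p (some i)) := upd_le i hp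
    by_cases hpQ : p ∈ Q
    · by_cases hQp : (Q.erase p).Nonempty
      · refine (ih (Q.erase p) hQp (fun h => h0 (Finset.mem_of_mem_erase h)) ?_).trans
          (cut_mono hle (Finset.erase_subset _ _) ?_)
        · intro q hq
          have := hQ q (Finset.mem_of_mem_erase hq)
          simpa [Finset.ne_of_mem_erase hq] using this
        · intro q hq hq'
          have : q = p := by by_contra hne; exact hq' (Finset.mem_erase.2 ⟨hne, hq⟩)
          rw [this]; exact hp
      · have : Q = {p} := by
          rw [Finset.not_nonempty_iff_eq_empty] at hQp
          ext q; constructor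
          · intro hq
            by_contra hne
            have : q ∈ Q.erase p := Finset.mem_erase.2 ⟨by simpa using hne, hq⟩
            simp [hQp] at this
          · intro hq; simp at hq; rw [hq]; exact hpQ
        subst this
        rw [cut_single (S := S) (i := i) (by simp)]
        exact ht.trans (hsat.mono hle).sum
    · refine (ih Q hne h0 ?_).trans (cut_mono hle (Finset.Subset.refl _) ?_)
      · intro q hq
        have hqp : q ≠ p := by rintro rfl; exact hpQ hq
        simpa [hqp] using hQ q hq
      · intro q h1 h2; exact absurd h1 h2

structure PhaseDet (step : ℕ → Config → Config → Prop) (τ : ℕ) (C D : Config) : Prop where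
  term : PhaseTerminates (step τ) C
  reach : Relation.ReflTransGen (step τ) C D
  fin : Terminal (step τ) D
  uniq : ∀ E, Relation.ReflTransGen (step τ) C E → Terminal (step τ) E → E = D

inductive Run (step : ℕ → Config → Config → Prop) : List ℕ → Config → Config → Prop
  | nil {C : Config} : Run step [] C C
  | cons {τ : ℕ} {τs : List ℕ} {C D E : Config} : PhaseDet step τ C D → Run step τs D E →
      Run step (τ :: τs) C E

lemma Run.append {step : ℕ → Config → Config → Prop} {l l' : List ℕ} {C D E : Config}
    (h : Run step l C D) (h' : Run step l' D E) : Run step (l ++ l') C E := by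
  induction h with
  | nil => exact h'
  | cons h1 _ ih => exact Run.cons h1 (ih h')

lemma Run.all {step : ℕ → Config → Config → Prop} {l : List ℕ} {C D : Config}
    (h : Run step l C D) : AllFinish step l C ∧ MultiReach step l C D ∧
      ∀ E, MultiReach step l C E → E = D := by
  induction h with
  | nil => exact ⟨AllFinish.nil, MultiReach.nil, fun E h => by cases h; rfl⟩
  | cons h1 _ ih =>
    refine ⟨AllFinish.cons h1.term ?_, MultiReach.cons h1.reach h1.fin ih.2.1, ?_⟩
    · intro D hD hT
      rw [h1.uniq D hD hT]; exact ih.1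
    · intro E hE
      cases hE with
      | cons a b c =>
        rw [h1.uniq _ a b] at c
        exact ih.2.2 E c

lemma no_inf {step : Config → Config → Prop} {C : Config} (Inv : Config → Prop) (μ : Config → ℕ)
    (h0 : Inv C) (hs : ∀ C D, Inv C → step C D → Inv D ∧ μ D < μ C) : PhaseTerminates step C := by
  rintro ⟨f, f0, hf⟩
  have hI : ∀ n, Inv (f n) := by
    intro n
    induction n with
    | zero => rw [f0]; exact h0
    | succ n ih => exact (hs _ _ ih (hf n)).1
  have hm : ∀ n, μ (f n) + n ≤ μ (f 0) := by
    intro n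
    induction n with
    | zero => simp
    | succ n ih => have := (hs _ _ (hI n) (hf n)).2; omega
  have := hm (μ (f 0) + 1)
  omega

lemma rtg_inv {step : Config → Config → Prop} {C D : Config} (Inv : Config → Prop)
    (h0 : Inv C) (hs : ∀ C D, Inv C → step C D → Inv D) (h : Relation.ReflTransGen step C D) :
    Inv D := by
  induction h with
  | refl => exact h0
  | tail _ h2 ih => exact hs _ _ ih h2

section phase
variable [Fintype ι]
variable (S) in
def tiles : Finset Tile := Finset.univ.image (tl S)

lemma add_single {τ : ℕ} {c : TC ι} {p : ℤ × ℤ} {i : ι} (hp : c p = none)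
    (ht : τ ≤ ∑ d, ob S c p i d) :
    MStep (tiles S) S.G τ (toC S c) (toC S (Function.update c p (some i))) := by
  have hA : Addable (tiles S) S.G τ (toC S (single p i)) := by
    have h := Addable.translate (T := tiles S) (G := S.G) (τ := τ) p
      (Addable.single (t := tl S i) (by simp [tiles]))
    convert h using 1
    funext q
    unfold toC single translateConfig singleTile
    have : (q - p = (0, 0)) ↔ q = p := sub_eq_zero
    by_cases hq : q = p
    · rw [if_pos (this.2 hq), if_pos hq]; rfl
    · rw [if_neg (fun h => hq (this.1 h)), if_neg hq]; rfl
  have e : toC S (Function.update c p (some i)) = unionConfig (toC S c) (toC S (single p i)) := by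
    rw [un_toC]
    congr 1
    funext q
    by_cases hq : q = p
    · subst hq; simp [un, hp, single]
    · unfold un single
      simp [hq]; cases c q <;> rfl
  rw [e]
  refine MStep.attach {p} hA ?_ ?_ ?_
  · intro q
    by_cases hq : q = p
    · subst hq; left; simp [toC, hp]
    · right; simp [toC, single, hq]
  · rw [shape_toC]
    ext q; simp [single]
  · rw [inter_eq, Finset.sum_singleton]
    simpa [xb, single] using ht

/-- analysis of a step -/
lemma step_cases {lo τ : ℕ} (g : Good S lo) (hlo : lo ≤ τ) (h1 : 1 ≤ τ) {c : TC ι} {E : Config}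
    (h : MStep (tiles S) S.G τ (toC S c) E) :
    (∃ a r i, ∃ F : Finset (ℤ × ℤ), E = toC S (un c a) ∧ Gr S τ (single r i) a ∧
      (∀ p, c p = none ∨ a p = none) ∧
      τ ≤ ∑ p ∈ F, ∑ d, xb S a c p d) ∨
    (∃ Q : Finset (ℤ × ℤ), Q.Nonempty ∧ ((0, 0) : ℤ × ℤ) ∉ Q ∧ (∀ p ∈ Q, c p ≠ none) ∧
      cutT S c Q < τ ∧ E = toC S (fun q => if q ∈ Q then none else c q)) := by
  generalize hC : toC S c = C at h
  cases h with
  | @attach A F hA hd hF ht =>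
    subst hC
    left
    obtain ⟨a, r, i, rfl, ha⟩ := addable_fl g hlo h1 hA
    rw [inter_eq] at ht
    simp only [toC_none] at hd
    refine ⟨a, r, i, F, un_toC _ _ _, ha, hd, ht⟩
  | detach Q h2 h3 h4 h5 =>
    subst hC
    right
    rw [cut_eq] at h5
    refine ⟨Q, h2, h3, ?_, h5, ?_⟩
    · intro p hp
      have := h4 (Finset.mem_coe.2 hp)
      rw [shape_toC] at this; exact this
    · funext q; by_cases hq : q ∈ Q <;> simp [toC, hq]

lemma rem_set {τ : ℕ} {c : TC ι} (Q : Finset (ℤ × ℤ)) (h1 : Q.Nonempty)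
    (h2 : ((0, 0) : ℤ × ℤ) ∉ Q) (h3 : ∀ p ∈ Q, c p ≠ none) (h4 : cutT S c Q < τ) :
    MStep (tiles S) S.G τ (toC S c) (toC S (fun q => if q ∈ Q then none else c q)) := by
  have h := MStep.detach (T := tiles S) (G := S.G) (τ := τ) (C := toC S c) Q h1 h2
    (by rw [shape_toC]; exact fun p hp => h3 p hp) (by rw [cut_eq]; exact h4)
  convert h using 1
  funext q; by_cases hq : q ∈ Q <;> simp [toC, hq]

theorem growth {lo τ : ℕ} (g : Good S lo) (hlo : lo ≤ τ) (h1 : 1 ≤ τ) {c0 D : TC ι}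
    (hst : Stable S τ c0) (hfin : {p | D p ≠ none}.Finite) (h0 : Le c0 D)
    (hQX : ∀ c, Gr S τ c0 c → Le c D → QX S τ c)
    (hdet : ∀ c, Gr S τ c0 c → Le c D → ∀ p i, c p = none → Sat S c p i → τ ≤ isum S i →
      D p = some i)
    (hprog : ∀ c, Gr S τ c0 c → Le c D → c ≠ D → ∃ p i, c p = none ∧ Sat S c p i ∧ τ ≤ isum S i) :
    PhaseDet (MStep (tiles S) S.G) τ (toC S c0) (toC S D) ∧ Gr S τ c0 D := by
  have Gle : ∀ c, Gr S τ c0 c → Le c D := by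
    intro c hc
    induction hc with
    | refl => exact h0
    | @add c p i h hp hs ht ih =>
      intro q j hq
      by_cases hqp : q = p
      · subst hqp; simp at hq; subst hq
        exact hdet c h ih _ _ hp hs ht
      · simp [hqp] at hq; exact ih _ _ hq
  have stp : ∀ c E, Gr S τ c0 c → MStep (tiles S) S.G τ (toC S c) E →
      ∃ c', E = toC S c' ∧ Gr S τ c0 c' ∧ Le c c' ∧ ∃ p, c p = none ∧ c' p ≠ none := by
    intro c E hc hE
    rcases step_cases g hlo h1 hE with ⟨a, r, i, F, rfl, ha, hd, ht⟩ | ⟨Q, h2, h3, h4, h5, rfl⟩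
    · have hg := attach_gr g hlo ha hd ht (hQX c hc (Gle c hc))
      refine ⟨_, rfl, hc.trans hg, hg.le, r, ?_, ?_⟩
      · rcases hd r with h | h
        · exact h
        · rw [ha.root] at h; cases h
      · have : c r = none := by
          rcases hd r with h | h
          · exact h
          · rw [ha.root] at h; cases h
        simp [un, this, ha.root]
    · have := (hst.gr hc) Q h2 h3 h4
      omega
  have one : ∀ c, Gr S τ c0 c → c ≠ D → ∃ c', MStep (tiles S) S.G τ (toC S c) (toC S c') ∧
      Gr S τ c0 c' := by
    intro c hc hne
    obtain ⟨p, i, hp, hs, ht⟩ := hprog c hc (Gle c hc) hne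
    exact ⟨_, add_single hp (ht.trans hs.sum), Gr.add hc hp hs ht⟩
  let μ : Config → ℕ := fun C => ({p | D p ≠ none ∧ C p = none} : Set (ℤ × ℤ)).ncard
  have dec : ∀ C E, (∃ c, C = toC S c ∧ Gr S τ c0 c) → MStep (tiles S) S.G τ C E →
      (∃ c, E = toC S c ∧ Gr S τ c0 c) ∧ μ E < μ C := by
    rintro C E ⟨c, rfl, hc⟩ hE
    obtain ⟨c', rfl, hc', hle, p, hp, hp'⟩ := stp c E hc hE
    refine ⟨⟨c', rfl, hc'⟩, ?_⟩
    refine Set.ncard_lt_ncard ?_ (hfin.subset fun q hq => hq.1)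
    rw [Set.ssubset_iff_of_subset]
    · refine ⟨p, ⟨?_, by simp [toC, hp]⟩, ?_⟩
      · obtain ⟨k, hk⟩ := Option.ne_none_iff_exists'.1 hp'
        rw [Gle c' hc' _ _ hk]; simp
      · rintro ⟨_, h⟩
        exact hp' ((toC_none S).1 h)
    · rintro q ⟨h2, h3⟩
      refine ⟨h2, ?_⟩
      rw [toC_none] at h3 ⊢
      exact Le.nn hle h3
  have reach : ∀ n c, Gr S τ c0 c → μ (toC S c) ≤ n →
      Relation.ReflTransGen (MStep (tiles S) S.G τ) (toC S c) (toC S D) ∧ Gr S τ c0 D := by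
    intro n
    induction n with
    | zero =>
      intro c hc hn
      by_cases hD : c = D
      · subst hD; exact ⟨Relation.ReflTransGen.refl, hc⟩
      · obtain ⟨c', h2, h3⟩ := one c hc hD
        have := (dec _ _ ⟨c, rfl, hc⟩ h2).2
        omega
    | succ n ih =>
      intro c hc hn
      by_cases hD : c = D
      · subst hD; exact ⟨Relation.ReflTransGen.refl, hc⟩
      · obtain ⟨c', h2, h3⟩ := one c hc hD
        have := (dec _ _ ⟨c, rfl, hc⟩ h2).2
        obtain ⟨h4, h5⟩ := ih c' h3 (by omega)
        exact ⟨Relation.ReflTransGen.head h2 h4, h5⟩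
  obtain ⟨r1, r2⟩ := reach _ c0 Gr.refl le_rfl
  refine ⟨⟨no_inf _ μ ⟨c0, rfl, Gr.refl⟩ dec, r1, ?_, ?_⟩, r2⟩
  · intro E hE
    obtain ⟨c', rfl, hc', hle, p, hp, hp'⟩ := stp D E r2 hE
    obtain ⟨k, hk⟩ := Option.ne_none_iff_exists'.1 hp'
    rw [Gle c' hc' _ _ hk] at hp; cases hp
  · intro E hE hT
    obtain ⟨c, rfl, hc⟩ := rtg_inv (fun C => ∃ c, C = toC S c ∧ Gr S τ c0 c)
      ⟨c0, rfl, Gr.refl⟩ (fun C D h h' => (dec C D h h').1) hE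
    by_cases hD : c = D
    · rw [hD]
    · obtain ⟨c', h2, _⟩ := one c hc hD
      exact absurd h2 (hT _)

lemma prog_of_rank {τ : ℕ} {c0 D : TC ι} {κ : Type} [LinearOrder κ] (rk : ℤ × ℤ → κ)
    (hfin : {p | D p ≠ none}.Finite)
    (h : ∀ p i, D p = some i → c0 p = none → τ ≤ isum S i ∧ ∀ d, S.inp i d = true →
      ∃ j, D (nb d p) = some j ∧ S.gl j (op d) = S.gl i d ∧
        (c0 (nb d p) = some j ∨ rk (nb d p) < rk p)) :
    ∀ c, Gr S τ c0 c → Le c D → c ≠ D → ∃ p i, c p = none ∧ Sat S c p i ∧ τ ≤ isum S i := by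
  intro c hc hle hne
  have hfin' : {p | D p ≠ none ∧ c p = none}.Finite := hfin.subset fun p hp => hp.1
  have hnon : hfin'.toFinset.Nonempty := by
    by_contra hcon
    apply hne
    refine Le.antisymm hle fun p hp => ?_
    by_contra hD
    exact hcon ⟨p, by simpa using ⟨hD, hp⟩⟩
  obtain ⟨p, hp, hmin⟩ := Finset.exists_min_image _ rk hnon
  simp only [Set.Finite.mem_toFinset, Set.mem_ofPred_eq] at hp hmin
  obtain ⟨i, hi⟩ := Option.ne_none_iff_exists'.1 hp.1
  have hc0 : c0 p = none := Le.nn hc.le hp.2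
  obtain ⟨h2, h3⟩ := h p i hi hc0
  refine ⟨p, i, hp.2, ?_, h2⟩
  intro d hd
  obtain ⟨j, h4, h5, h6⟩ := h3 d hd
  refine ⟨j, ?_, h5⟩
  rcases h6 with h6 | h6
  · exact hc.le _ _ h6
  · cases hcc : c (nb d p) with
    | none => exact absurd (hmin _ ⟨by rw [h4]; simp, hcc⟩) (not_le.2 h6)
    | some k => rw [hle _ _ hcc] at h4; exact h4
end phase
end TA

namespace TA

inductive Ty
  | sd | t1 | t2 | u0 | u1 | u2 | Q | Qp | P | DA0 | DA | DB | J | EB | FB | FA | FAp | FA3 | Y | M0 | M | G | R | X | Xg | D0 | D | E | F | H0 | H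
deriving DecidableEq

instance : Fintype Ty := ⟨⟨([.sd, .t1, .t2, .u0, .u1, .u2, .Q, .Qp, .P, .DA0, .DA, .DB, .J, .EB, .FB, .FA, .FAp, .FA3, .Y, .M0, .M, .G, .R, .X, .Xg, .D0, .D, .E, .F, .H0, .H] : List Ty), by decide⟩,
  by intro x; cases x <;> decide⟩

def q4 (a b c d : ℕ) : Dir → ℕ
  | .n => a | .e => b | .s => c | .w => d
def b4 (a b c d : Bool) : Dir → Bool
  | .n => a | .e => b | .s => c | .w => d

/-- glue code = 100 * identifier + strength -/
def gl : Ty → Dir → ℕ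
  | .sd => q4 144 1731 2899 2999
  | .t1 => q4 0 2999 0 3099
  | .t2 => q4 0 3099 0 0
  | .u0 => q4 2899 1831 2146 3199
  | .u1 => q4 0 3199 2636 3299
  | .u2 => q4 0 3299 2636 0
  | .Q => q4 1015 1731 1931 1731
  | .Qp => q4 1110 1731 1931 1731
  | .P => q4 1931 1831 2020 1831
  | .DA0 => q4 344 935 144 0
  | .DA => q4 344 935 244 0
  | .DB => q4 444 735 344 0
  | .J => q4 0 542 444 0
  | .EB => q4 244 835 1215 735
  | .FB => q4 1315 835 1215 835
  | .FA => q4 1215 935 1015 935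
  | .FAp => q4 1215 935 1110 935
  | .FA3 => q4 1215 935 1315 935
  | .Y => q4 0 0 607 542
  | .M0 => q4 607 1642 1442 735
  | .M => q4 1110 1642 1442 835
  | .G => q4 0 0 1542 1642
  | .R => q4 1015 835 1442 835
  | .X => q4 1442 0 1015 0
  | .Xg => q4 1542 0 1110 0
  | .D0 => q4 2146 2330 2736 2510
  | .D => q4 2246 2330 2736 2510
  | .E => q4 2020 2430 2246 2330
  | .F => q4 2020 2430 2020 2430
  | .H0 => q4 2636 2510 2736 2510
  | .H => q4 2736 2510 2736 2510
def inp : Ty → Dir → Bool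
  | .sd => b4 false false false false
  | .t1 | .t2 | .u1 | .u2 => b4 false true false false
  | .u0 | .X | .Xg | .D0 | .D => b4 true false false false
  | .Q | .Qp | .P | .M0 | .M | .R | .E | .F => b4 true false false true
  | .DA0 | .DA | .DB | .J => b4 false false true false
  | .EB | .FB | .FA | .FAp | .FA3 => b4 false false true true
  | .Y | .G => b4 false false false true
  | .H0 | .H => b4 true true false false
def lf : Ty → Bool
  | .t1 | .t2 | .u1 | .u2 | .H0 | .H => true
  | _ => false

def TS : Sys Ty := ⟨gl, fun g => g % 100, inp, lf⟩

lemma goodTS : Good TS 40 where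
  G0 := rfl
  A1 := by decide +kernel
  A2 := by decide +kernel
  A3 := by decide +kernel
  A3e := by decide +kernel
  A3' := by decide +kernel
  A4 := by decide +kernel
  A5 := by decide +kernel

/-- parameters -/
structure Pm where
  L : ℤ
  M : ℤ
  A : ℤ
  B : ℤ
  Z : ℤ
  β : ℤ → ℤ

def reg (P : Pm) : Ty → ℤ → ℤ → Prop
  | .sd, x, y => x = 0 ∧ y = 0
  | .t1, x, y => x = -1 ∧ y = 0
  | .t2, x, y => x = -2 ∧ y = 0
  | .u0, x, y => x = 0 ∧ y = -1
  | .u1, x, y => x = -1 ∧ y = -1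
  | .u2, x, y => x = -2 ∧ y = -1
  | .Q, x, y => y = 0 ∧ 1 ≤ x ∧ x < P.M ∧ P.β x = 0
  | .Qp, x, y => y = 0 ∧ 1 ≤ x ∧ x < P.M ∧ P.β x ≠ 0
  | .P, x, y => y = -1 ∧ 1 ≤ x ∧ x < P.M
  | .D0, x, y => x = 0 ∧ y = -2 ∧ P.Z ≤ y
  | .D, x, y => x + y = -2 ∧ 1 ≤ x ∧ x < P.M ∧ P.Z ≤ y
  | .E, x, y => x + y = -1 ∧ 1 ≤ x ∧ x < P.M ∧ P.Z ≤ y ∧ y ≤ -2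
  | .F, x, y => 0 ≤ x + y ∧ y ≤ -2 ∧ x < P.M ∧ P.Z ≤ y
  | .H0, x, y => y = -2 ∧ -2 ≤ x ∧ x ≤ -1 ∧ P.Z ≤ y
  | .H, x, y => y ≤ -3 ∧ -2 ≤ x ∧ x + y ≤ -3 ∧ P.Z ≤ y
  | .DA0, x, y => x = 0 ∧ y = 1 ∧ x < P.A
  | .DA, x, y => y = 2 * x + 1 ∧ 1 ≤ x ∧ x < P.A
  | .DB, x, y => y = 2 * x + 2 ∧ 0 ≤ x ∧ x < P.A
  | .J, x, y => y = 2 * x + 3 ∧ 0 ≤ x ∧ x < P.A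
  | .EB, x, y => y = 2 * x ∧ 1 ≤ x ∧ x < P.A
  | .FB, x, y => y % 2 = 0 ∧ 2 ≤ y ∧ y ≤ 2 * x - 2 ∧ x < P.A
  | .FA, x, y => y = 1 ∧ 1 ≤ x ∧ x < P.A ∧ P.β x = 0
  | .FAp, x, y => y = 1 ∧ 1 ≤ x ∧ x < P.A ∧ P.β x ≠ 0
  | .FA3, x, y => y % 2 = 1 ∧ 3 ≤ y ∧ y ≤ 2 * x - 1 ∧ x < P.A
  | .Y, x, y => x = P.L ∧ y = 2 * P.L + 1 ∧ x < P.B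
  | .M0, x, y => x = P.L ∧ y = 2 * P.L ∧ x < P.B
  | .G, x, y => P.L ≤ x ∧ x < P.B ∧ y % 2 = 0 ∧ 2 ≤ y ∧ y ≤ 2 * P.L ∧ 2 * x + y = 4 * P.L + 2
  | .M, x, y => P.L ≤ x ∧ x < P.B ∧ y % 2 = 0 ∧ 2 ≤ y ∧ y ≤ 2 * P.L - 2 ∧ 2 * x + y = 4 * P.L
  | .R, x, y => P.L ≤ x ∧ x < P.B ∧ y % 2 = 0 ∧ 2 ≤ y ∧ 2 * x + y ≤ 4 * P.L - 2
  | .X, x, y => P.L ≤ x ∧ x < P.B ∧ y % 2 = 1 ∧ 1 ≤ y ∧ 2 * x + y ≤ 4 * P.L - 1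
  | .Xg, x, y => P.L ≤ x ∧ x < P.B ∧ y % 2 = 1 ∧ 1 ≤ y ∧ y ≤ 2 * P.L - 1 ∧ 2 * x + y = 4 * P.L + 1

structure Pm.Ok (P : Pm) : Prop where
  L1 : 1 ≤ P.L
  LM : P.L ≤ P.M
  A : P.A = 0 ∨ P.A = P.L
  B : P.B = P.L ∨ P.B = 2 * P.L + 1
  Z : P.Z = -1 ∨ P.Z = -1 - P.M

set_option maxHeartbeats 4000000 in
lemma reg_uniq {P : Pm} (h : P.Ok) {j k : Ty} {x y : ℤ} (hj : reg P j x y) (hk : reg P k x y) :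
    j = k := by
  obtain ⟨h1, h2, h3, h4, h5⟩ := h
  cases j <;> simp only [reg] at hj <;> cases k <;> first | rfl | (exfalso; simp only [reg] at hk; omega)

open Classical in
noncomputable def cf (P : Pm) : TC Ty := fun p =>
  if h : ∃ k, reg P k p.1 p.2 then some h.choose else none

lemma cf_some {P : Pm} (h : P.Ok) {k : Ty} {p : ℤ × ℤ} : cf P p = some k ↔ reg P k p.1 p.2 := by
  unfold cf
  constructor
  · intro h'
    split_ifs at h' with h2
    cases h'
    exact h2.choose_spec
  · intro h'
    have h2 : ∃ k, reg P k p.1 p.2 := ⟨k, h'⟩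
    rw [dif_pos h2, reg_uniq h h2.choose_spec h']

lemma cf_none {P : Pm} {p : ℤ × ℤ} : cf P p = none ↔ ∀ k, ¬ reg P k p.1 p.2 := by
  unfold cf
  split_ifs with h
  · simpa using h
  · push Not at h; simpa using h

lemma ex_ty {p : Ty → Prop} : (∃ k, p k) ↔ p .sd ∨ p .t1 ∨ p .t2 ∨ p .u0 ∨ p .u1 ∨ p .u2 ∨ p .Q ∨ p .Qp ∨ p .P ∨ p .DA0 ∨ p .DA ∨ p .DB ∨ p .J ∨ p .EB ∨ p .FB ∨ p .FA ∨ p .FAp ∨ p .FA3 ∨ p .Y ∨ p .M0 ∨ p .M ∨ p .G ∨ p .R ∨ p .X ∨ p .Xg ∨ p .D0 ∨ p .D ∨ p .E ∨ p .F ∨ p .H0 ∨ p .H := by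
  constructor
  · rintro ⟨k, hk⟩; cases k <;> simp only [hk, true_or, or_true]
  · intro h
    rcases h with h | h | h | h | h | h | h | h | h | h | h | h | h | h | h | h | h | h | h | h | h | h | h | h | h | h | h | h | h | h | h <;> exact ⟨_, h⟩
end TA

namespace TA

/-- admissible regimes -/
def Reg (P : Pm) (τ : ℕ) : Prop :=
  (τ = 62 ∧ P.M = P.L ∧ P.A = 0 ∧ P.B = P.L ∧ P.Z = -1) ∨
  (τ = 46 ∧ P.M = P.L ∧ P.A = 0 ∧ P.B = P.L ∧ P.Z = -1 - P.M) ∨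
  (τ = 44 ∧ P.M = P.L ∧ P.A = P.L ∧ P.B = P.L ∧ P.Z = -1 - P.M) ∨
  (τ = 42 ∧ P.M = 2 * P.L ∧ P.A = P.L ∧ P.B = 2 * P.L + 1 ∧ P.Z = -1 - P.M ∧
    ∀ x, (P.L ≤ x ∧ x < 2 * P.L → P.β x = 0) ∧ (x = 2 * P.L → P.β x = 1)) ∨
  (τ = 40 ∧ P.M = 2 * P.L + 1 ∧ P.A = P.L ∧ P.B = 2 * P.L + 1 ∧ P.Z = -1 - P.M ∧
    ∀ x, (P.L ≤ x ∧ x < 2 * P.L → P.β x = 0) ∧ (x = 2 * P.L → P.β x = 1))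

lemma reg_at {P : Pm} {τ : ℕ} (h : Reg P τ) (x : ℤ) :
  (τ = 62 ∧ P.M = P.L ∧ P.A = 0 ∧ P.B = P.L ∧ P.Z = -1) ∨
  (τ = 46 ∧ P.M = P.L ∧ P.A = 0 ∧ P.B = P.L ∧ P.Z = -1 - P.M) ∨
  (τ = 44 ∧ P.M = P.L ∧ P.A = P.L ∧ P.B = P.L ∧ P.Z = -1 - P.M) ∨
  ((τ = 42 ∧ P.M = 2 * P.L ∨ τ = 40 ∧ P.M = 2 * P.L + 1) ∧ P.A = P.L ∧ P.B = 2 * P.L + 1 ∧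
    P.Z = -1 - P.M ∧ (P.L ≤ x ∧ x < 2 * P.L → P.β x = 0) ∧ (x = 2 * P.L → P.β x = 1)) := by
  rcases h with h | h | h | ⟨h1, h2, h3, h4, h5, h6⟩ | ⟨h1, h2, h3, h4, h5, h6⟩
  · exact Or.inl h
  · exact Or.inr (Or.inl h)
  · exact Or.inr (Or.inr (Or.inl h))
  · exact Or.inr (Or.inr (Or.inr ⟨Or.inl ⟨h1, h2⟩, h3, h4, h5, h6 x⟩))
  · exact Or.inr (Or.inr (Or.inr ⟨Or.inr ⟨h1, h2⟩, h3, h4, h5, h6 x⟩))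

/-- isum table -/
def ist : Ty → ℕ
  | .sd => 0 | .t1 | .t2 | .u0 | .u1 | .u2 => 99 | .Q => 46 | .Qp => 41 | .P => 62
  | .DA0 | .DA | .DB | .J => 44 | .FAp | .M => 45
  | .Y | .M0 | .G | .X | .Xg => 42 | .D0 | .D | .H0 | .H => 46 | _ => 50
lemma isum_eq (i : Ty) : isum TS i = ist i := by revert i; decide +kernel

def l4 (a b c d : List Ty) : Dir → List Ty
  | .n => a | .e => b | .s => c | .w => d
def pl : Ty → Dir → List Ty
  | .sd => l4 [.DA0] [.Q, .Qp] [.u0] [.t1]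
  | .t1 => l4 [] [.sd] [] [.t2]
  | .t2 => l4 [] [.t1] [] []
  | .u0 => l4 [.sd] [.P] [.D0] [.u1]
  | .u1 => l4 [] [.u0] [.H0] [.u2]
  | .u2 => l4 [] [.u1] [.H0] []
  | .Q => l4 [.FA, .X] [.Q, .Qp] [.P] [.sd, .Q, .Qp]
  | .Qp => l4 [.FAp, .Xg] [.Q, .Qp] [.P] [.sd, .Q, .Qp]
  | .P => l4 [.Q, .Qp] [.P] [.E, .F] [.u0, .P]
  | .DA0 => l4 [.DB] [.FA, .FAp, .FA3] [.sd] []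
  | .DA => l4 [.DB] [.FA, .FAp, .FA3] [.EB] []
  | .DB => l4 [.J] [.EB, .M0] [.DA0, .DA] []
  | .J => l4 [] [.Y] [.DB] []
  | .EB => l4 [.DA] [.FB, .M, .R] [.FA, .FAp, .FA3] [.DB]
  | .FB => l4 [.FA3] [.FB, .M, .R] [.FA, .FAp, .FA3] [.EB, .FB, .R]
  | .FA => l4 [.EB, .FB] [.FA, .FAp, .FA3] [.Q, .R] [.DA0, .DA, .FA, .FAp, .FA3]
  | .FAp => l4 [.EB, .FB] [.FA, .FAp, .FA3] [.Qp, .M] [.DA0, .DA, .FA, .FAp, .FA3]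
  | .FA3 => l4 [.EB, .FB] [.FA, .FAp, .FA3] [.FB] [.DA0, .DA, .FA, .FAp, .FA3]
  | .Y => l4 [] [] [.M0] [.J]
  | .M0 => l4 [.Y] [.G] [.X] [.DB]
  | .M => l4 [.FAp, .Xg] [.G] [.X] [.EB, .FB, .R]
  | .G => l4 [] [] [.Xg] [.M0, .M]
  | .R => l4 [.FA, .X] [.FB, .M, .R] [.X] [.EB, .FB, .R]
  | .X => l4 [.M0, .M, .R] [] [.Q, .R] []
  | .Xg => l4 [.G] [] [.Qp, .M] []
  | .D0 => l4 [.u0] [.E] [.H] [.H0, .H]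
  | .D => l4 [.E] [.E] [.H] [.H0, .H]
  | .E => l4 [.P, .F] [.F] [.D] [.D0, .D]
  | .F => l4 [.P, .F] [.F] [.E, .F] [.E, .F]
  | .H0 => l4 [.u1, .u2] [.D0, .D, .H0, .H] [.H] [.H0, .H]
  | .H => l4 [.D0, .D, .H0, .H] [.D0, .D, .H0, .H] [.H] [.H0, .H]

lemma pl_iff {i j : Ty} {d : Dir} (h : gl i d ≠ 0) : gl j (op d) = gl i d ↔ j ∈ pl i d := by
  revert i j d; decide +kernel
lemma inp_ne {i : Ty} {d : Dir} (h : inp i d = true) : gl i d ≠ 0 := by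
  revert i d; decide +kernel

set_option maxHeartbeats 4000000 in
lemma det {P : Pm} {τ : ℕ} (hP : P.Ok) (hr : Reg P τ) {x y : ℤ} {i : Ty}
    (hs : Sat TS (cf P) (x, y) i) (ht : τ ≤ isum TS i) :
    reg P i x y ∨ (τ ≤ 42 ∧ i = .Y ∧ reg P .DA x y) ∨
      (τ ≤ 42 ∧ x = P.L ∧ (i = .FA ∨ i = .FAp)) := by
  have H : ∀ d, inp i d = true → ∃ j, j ∈ pl i d ∧
      reg P j (nb d (x, y)).1 (nb d (x, y)).2 := by
    intro d hd
    obtain ⟨j, h1, h2⟩ := hs d hd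
    exact ⟨j, (pl_iff (inp_ne hd)).1 h2, (cf_some hP).1 h1⟩
  rw [isum_eq] at ht
  clear hs
  have hr := reg_at hr x
  obtain ⟨h1, h2, -, -, -⟩ := hP
  have hn := H .n
  have he := H .e
  have hs := H .s
  have hw := H .w
  clear H
  obtain ⟨L, M, A, B, Z, β⟩ := P
  simp only at h1 h2 hr
  cases i <;>
    simp only [ist, inp, b4, forall_const, Bool.false_eq_true, IsEmpty.forall_iff, pl, l4,
      List.mem_cons, List.not_mem_nil, or_false, or_and_right, exists_or, exists_eq_left, reg, nb,
      reduceCtorEq, false_and, and_false, false_or, or_true, true_or, and_true, true_and] at ht hn he hs hw ⊢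
  all_goals
    rcases hr with ⟨rfl, rfl, rfl, rfl, rfl⟩ | ⟨rfl, rfl, rfl, rfl, rfl⟩ | ⟨rfl, rfl, rfl, rfl, rfl⟩ |
    ⟨h3, rfl, rfl, rfl, h4, h5⟩
  all_goals omega
end TA

namespace TA

def r1 (P : Pm) (p : ℤ × ℤ) : ℤ := if 0 ≤ p.1 ∧ -2 ≤ p.1 + p.2 then p.1 else 4 * P.L + 4 - p.1
def r2 (P : Pm) (p : ℤ × ℤ) : ℤ := if 1 ≤ p.2 ∧ p.1 < P.L then p.2 else -p.2

lemma rk_lt {P : Pm} {τ : ℕ} (hP : P.Ok) (hr : Reg P τ) {x y : ℤ} {i : Ty}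
    (h : reg P i x y) (hq : 0 < x → x < P.L → y ≠ 0) (d : Dir) (hd : inp i d = true) :
    r1 P (nb d (x, y)) < r1 P (x, y) ∨
      r1 P (nb d (x, y)) = r1 P (x, y) ∧ r2 P (nb d (x, y)) < r2 P (x, y) := by
  have hr := reg_at hr x
  obtain ⟨h1, h2, h3, h4, h5⟩ := hP
  cases d
  all_goals
    cases i <;> first | (exfalso; revert hd; decide) | skip
  all_goals
    clear hd
    simp only [reg] at h
    simp only [nb, r1, r2]
    split_ifs <;> omega

set_option maxHeartbeats 4000000 in
lemma prog1 {P : Pm} {τ : ℕ} (hP : P.Ok) (hr : Reg P τ) {x y : ℤ} {i : Ty}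
    (h : reg P i x y) (hq : 0 < x → x < P.L → y ≠ 0 ∧ y ≠ -1) (hsd : i ≠ .sd) :
    τ ≤ ist i ∧ ∀ d, inp i d = true → ∃ j, j ∈ pl i d ∧
      reg P j (nb d (x, y)).1 (nb d (x, y)).2 := by
  have hr := reg_at hr x
  obtain ⟨h1, h2, h3, h4, h5⟩ := hP
  clear h3 h4 h5
  obtain ⟨L, M, A, B, Z, β⟩ := P
  simp only at h1 h2 hr hq
  constructor
  · cases i <;> simp only [ist, reg] at h ⊢ <;> first | omega | exact absurd rfl hsd
  · intro d hd
    cases d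
    all_goals
      cases i <;> first | (exfalso; revert hd; decide) | skip
    all_goals
      clear hd
      simp only [pl, l4, List.mem_cons, List.not_mem_nil, or_false, or_and_right, exists_or,
        exists_eq_left, reg, nb] at h ⊢
      rcases hr with ⟨rfl, rfl, rfl, rfl, rfl⟩ | ⟨rfl, rfl, rfl, rfl, rfl⟩ |
        ⟨rfl, rfl, rfl, rfl, rfl⟩ | ⟨h3, rfl, rfl, rfl, h4, h5⟩ <;> omega
end TA

namespace TA

lemma box {P : Pm} (hP : P.Ok) {k : Ty} {x y : ℤ} (h : reg P k x y) :
    -2 ≤ x ∧ x ≤ P.M + 2 * P.L + 2 ∧ -1 - P.M ≤ y ∧ y ≤ 2 * P.L + 3 := by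
  obtain ⟨h1, h2, h3, h4, h5⟩ := hP
  cases k <;> simp only [reg] at h <;> omega

lemma cf_fin {P : Pm} (hP : P.Ok) : {p | cf P p ≠ none}.Finite := by
  refine (((Set.finite_Icc (-2 : ℤ) (P.M + 2 * P.L + 2)).prod
    (Set.finite_Icc (-1 - P.M) (2 * P.L + 3)))).subset ?_
  intro p hp
  obtain ⟨k, hk⟩ := Option.ne_none_iff_exists'.1 hp
  have := box hP ((cf_some hP).1 hk)
  simp only [Set.mem_prod, Set.mem_Icc]; omega

lemma det_sat {P : Pm} {τ : ℕ} (hP : P.Ok) (hr : Reg P τ) {c : TC Ty} (hle : Le c (cf P))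
    {p : ℤ × ℤ} {i : Ty} (hs : Sat TS c p i) (ht : τ ≤ isum TS i) :
    cf P p = some i ∨ (τ ≤ 42 ∧ i = .Y ∧ reg P .DA p.1 p.2) ∨
      (τ ≤ 42 ∧ p.1 = P.L ∧ (i = .FA ∨ i = .FAp)) := by
  rw [cf_some hP]
  exact det hP hr (hs.mono hle) ht

def rk (P : Pm) (p : ℤ × ℤ) : ℤ ×ₗ ℤ := toLex (r1 P p, r2 P p)

lemma prog2 {P : Pm} {τ : ℕ} (hP : P.Ok) (hr : Reg P τ) {c0 : TC Ty}
    (h0 : cf P (0, 0) = some .sd → c0 (0, 0) ≠ none)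
    (hq : ∀ x y k, reg P k x y → 0 < x → x < P.L → y = 0 ∨ y = -1 → c0 (x, y) ≠ none) :
    ∀ c, Gr TS τ c0 c → Le c (cf P) → c ≠ cf P →
      ∃ p i, c p = none ∧ Sat TS c p i ∧ τ ≤ isum TS i := by
  refine prog_of_rank (rk P) (cf_fin hP) ?_
  rintro ⟨x, y⟩ i hi hc
  have hreg := (cf_some hP).1 hi
  have hq' : 0 < x → x < P.L → y ≠ 0 ∧ y ≠ -1 := by
    intro h1 h2
    constructor <;> intro h3
    · exact hq x y i hreg h1 h2 (Or.inl h3) hc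
    · exact hq x y i hreg h1 h2 (Or.inr h3) hc
  have hsd : i ≠ .sd := by
    rintro rfl
    simp only [reg] at hreg
    obtain ⟨rfl, rfl⟩ := hreg
    exact h0 hi hc
  obtain ⟨h1, h2⟩ := prog1 hP hr hreg hq' hsd
  refine ⟨by rw [isum_eq]; exact h1, fun d hd => ?_⟩
  obtain ⟨j, h3, h4⟩ := h2 d hd
  refine ⟨j, (cf_some hP).2 h4, (pl_iff (inp_ne hd)).2 h3, Or.inr ?_⟩
  unfold rk
  rw [Prod.Lex.toLex_lt_toLex]
  exact rk_lt hP hr hreg (fun a b => (hq' a b).1) d hd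

def kp (M : ℤ) (β : ℤ → ℤ) : Pm := ⟨M, M, 0, M, -1, β⟩
def fp (M : ℤ) (β : ℤ → ℤ) : Pm := ⟨M, M, 0, M, -1 - M, β⟩
def bp (M : ℤ) (β : ℤ → ℤ) : Pm := ⟨M, M, M, M, -1 - M, β⟩
def lp (L M : ℤ) (β : ℤ → ℤ) : Pm := ⟨L, M, L, 2 * L + 1, -1 - M, β⟩

lemma kp_ok {M : ℤ} {β : ℤ → ℤ} (h : 1 ≤ M) : (kp M β).Ok :=
  ⟨h, le_rfl, Or.inl rfl, Or.inl rfl, Or.inl rfl⟩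
lemma fp_ok {M : ℤ} {β : ℤ → ℤ} (h : 1 ≤ M) : (fp M β).Ok :=
  ⟨h, le_rfl, Or.inl rfl, Or.inl rfl, Or.inr rfl⟩
lemma bp_ok {M : ℤ} {β : ℤ → ℤ} (h : 1 ≤ M) : (bp M β).Ok :=
  ⟨h, le_rfl, Or.inr rfl, Or.inl rfl, Or.inr rfl⟩
lemma lp_ok {L M : ℤ} {β : ℤ → ℤ} (h : 1 ≤ L) (h' : L ≤ M) : (lp L M β).Ok :=
  ⟨h, h', Or.inr rfl, Or.inr rfl, Or.inr rfl⟩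

lemma kreg {M : ℤ} {β : ℤ → ℤ} {k : Ty} {x y : ℤ} (h : reg (kp M β) k x y) :
    (y = 0 ∨ y = -1) ∧ -2 ≤ x ∧ (x < M ∨ x ≤ 0) := by
  cases k <;> simp only [reg, kp] at h <;> omega

/-- the strip does not depend on the other parameters -/
lemma reg_strip {P P' : Pm} {k : Ty} {x y : ℤ} (h : reg P k x y) (hP : P.Ok) (hy : y = 0 ∨ y = -1)
    (h0 : x < P'.M ∨ x ≤ 0)
    (hβ : P'.β x = P.β x) : reg P' k x y := by
  obtain ⟨h1, h2, h3, h4, h5⟩ := hP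
  cases k <;> simp only [reg] at h ⊢ <;> omega

/-- inputs of core tiles -/
lemma in_core {M : ℤ} {β : ℤ → ℤ} {j : Ty} {x y : ℤ} (h : reg (kp M β) j x y)
    {d : Dir} (hd : inp j d = true) :
    (d = .n ∧ (j = .Q ∨ j = .Qp)) ∨ ∃ k, reg (kp M β) k (nb d (x, y)).1 (nb d (x, y)).2 := by
  cases d
  all_goals
    cases j <;> first | (exfalso; revert hd; decide) | (left; decide) | skip
  all_goals
    clear hd
    right
    simp only [reg, kp] at h
  all_goals first | (exfalso; omega) | skip
  · exact ⟨.sd, by simp only [reg, nb]; omega⟩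
  · by_cases hb : β x = 0
    · exact ⟨.Q, by simp only [reg, nb, kp]; omega⟩
    · exact ⟨.Qp, by simp only [reg, nb, kp]; omega⟩
  · exact ⟨.sd, by simp only [reg, nb]; omega⟩
  · exact ⟨.t1, by simp only [reg, nb]; omega⟩
  · exact ⟨.u0, by simp only [reg, nb]; omega⟩
  · exact ⟨.u1, by simp only [reg, nb]; omega⟩
  · by_cases hx : x = 1
    · exact ⟨.sd, by simp only [reg, nb]; omega⟩
    · by_cases hb : β (x - 1) = 0
      · exact ⟨.Q, by simp only [reg, nb, kp]; omega⟩
      · exact ⟨.Qp, by simp only [reg, nb, kp]; omega⟩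
  · by_cases hx : x = 1
    · exact ⟨.sd, by simp only [reg, nb]; omega⟩
    · by_cases hb : β (x - 1) = 0
      · exact ⟨.Q, by simp only [reg, nb, kp]; omega⟩
      · exact ⟨.Qp, by simp only [reg, nb, kp]; omega⟩
  · by_cases hx : x = 1
    · exact ⟨.u0, by simp only [reg, nb]; omega⟩
    · exact ⟨.P, by simp only [reg, nb, kp]; omega⟩

lemma Le.occ {c D : TC Ty} (h : Le c D) {p : ℤ × ℤ} (hp : c p ≠ none) : D p ≠ none := by
  obtain ⟨k, hk⟩ := Option.ne_none_iff_exists'.1 hp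
  rw [h _ _ hk]; simp

lemma occ_of {P : Pm} (hP : P.Ok) {k : Ty} {p : ℤ × ℤ} (h : reg P k p.1 p.2) : cf P p ≠ none := by
  rw [(cf_some hP).2 h]; simp

abbrev PD := PhaseDet (MStep (tiles TS) TS.G)

lemma stable_seed {τ : ℕ} : Stable TS τ (single (0, 0) .sd) := by
  intro Q h1 h2 h3
  obtain ⟨p, hp⟩ := h1
  exfalso
  have := h3 p hp
  unfold single at this
  split_ifs at this with h
  · subst h; exact h2 hp
  · exact this rfl

lemma phase_seed {β : ℤ → ℤ} : PD 62 (toC TS (single (0, 0) .sd)) (toC TS (cf (kp 1 β))) := by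
  have hP : (kp 1 β).Ok := kp_ok le_rfl
  have hr : Reg (kp 1 β) 62 := Or.inl ⟨rfl, rfl, rfl, rfl, rfl⟩
  refine (growth goodTS (by norm_num) (by norm_num) stable_seed (cf_fin hP) ?_ ?_ ?_ ?_).1
  · intro q j h
    unfold single at h
    split_ifs at h with hq
    cases h
    subst hq
    exact (cf_some hP).2 ⟨rfl, rfl⟩
  · intro c hc _ q j d i hq hd hn _
    exfalso
    rcases hc.new _ _ hq with h | ⟨_, h, _⟩
    · unfold single at h
      split_ifs at h
      cases h
      revert hd; cases d <;> decide
    · obtain ⟨k, hk, _⟩ := h d hd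
      rw [hk] at hn; cases hn
  · intro c _ hle p i _ hs ht
    rcases det_sat hP hr hle hs ht with h | h | h
    · exact h
    · exact absurd h.1 (by norm_num)
    · exact absurd h.1 (by norm_num)
  · refine prog2 hP hr (fun _ => by simp [single]) ?_
    intro x y k _ h1 h2
    simp only [kp] at h2; omega

lemma sb_f {i : Ty} {j : Ty} (hj : j = .Q ∨ j = .Qp) (h : 0 < bd TS j i .n) :
    inp i .s = true ∨ (ist i = 42 ∧ gl i .e = 0 ∧ gl i .w = 0 ∧ TS.G (gl i .s) ≤ 15 ∧
      ∀ k ∈ pl i .n, k = .M0 ∨ k = .M ∨ k = .R ∨ k = .G) := by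
  revert i j; decide +kernel

lemma ob_zero {c : TC Ty} {p : ℤ × ℤ} {i : Ty} {d : Dir} (h : gl i d = 0) : ob TS c p i d = 0 := by
  unfold ob
  cases c (nb d p) with
  | none => rfl
  | some j => 
    have := bd_le (S := TS) i j d
    have e : TS.G (TS.gl i d) = 0 := by show (gl i d) % 100 = 0; rw [h]
    simp only; omega

lemma ob_le {c : TC Ty} {p : ℤ × ℤ} {i : Ty} {d : Dir} : ob TS c p i d ≤ TS.G (gl i d) := by
  unfold ob
  cases c (nb d p) with
  | none => simp
  | some j => exact bd_le (S := TS) i j d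

lemma ob_pos' {c : TC Ty} {p : ℤ × ℤ} {i : Ty} {d : Dir} (h : 0 < ob TS c p i d) :
    ∃ j, c (nb d p) = some j ∧ gl j (op d) = gl i d ∧ gl i d ≠ 0 := by
  have h0 : gl i d ≠ 0 := by intro h'; rw [ob_zero h'] at h; omega
  unfold ob at h
  cases hc : c (nb d p) with
  | none => rw [hc] at h; simp at h
  | some j =>
    rw [hc] at h
    exact ⟨j, rfl, (bd_pos (S := TS) h).1, h0⟩

/-- growth from the core at temperature 46 or 44 -/
lemma phase_core {P : Pm} {τ : ℕ} {M : ℤ} {β : ℤ → ℤ} (hM : 1 ≤ M) (hP : P.Ok) (hr : Reg P τ)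
    (hτ : 44 ≤ τ) (hL : P.L = M) (hM' : P.M = M) (hB : P.B = M) (hb : P.β = β)
    (hst : Stable TS τ (cf (kp M β))) :
    PD τ (toC TS (cf (kp M β))) (toC TS (cf P)) ∧ Gr TS τ (cf (kp M β)) (cf P) := by
  have hK : (kp M β).Ok := kp_ok hM
  refine growth goodTS (by omega) (by omega) hst (cf_fin hP) ?_ ?_ ?_ ?_
  · intro q j h
    rw [cf_some hK] at h
    rw [cf_some hP]
    obtain ⟨h1, h2, h3⟩ := kreg h
    exact reg_strip h hK h1 (by rw [hM']; exact h3) (by rw [hb]; rfl)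
  · intro c hc hle q j d i hq hd hn hbd
    rcases hc.new _ _ hq with h | ⟨_, h, _⟩
    · rw [cf_some hK] at h
      rcases in_core h hd with ⟨rfl, hj⟩ | ⟨k, hk⟩
      · rcases sb_f hj hbd with h | ⟨h1, h2, h3, h4, h5⟩
        · exact Or.inl h
        · right
          refine ⟨by rw [isum_eq]; omega, fun p => ?_⟩
          rw [sum_dir, ob_zero h2, ob_zero h3]
          have e1 : ob TS c p i .s ≤ 15 := ob_le.trans h4
          have e2 : ob TS c p i .n = 0 := by
            by_contra hne
            obtain ⟨k, hk, hk2, hk3⟩ := ob_pos' (Nat.pos_of_ne_zero hne)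
            have hk4 := (cf_some hP).1 (hle _ _ hk)
            have := hP.L1
            rcases h5 k ((pl_iff hk3).1 hk2) with rfl | rfl | rfl | rfl <;>
              simp only [reg] at hk4 <;> omega
          omega
      · exact absurd hn (Le.occ hc.le (occ_of hK hk))
    · obtain ⟨k, hk, _⟩ := h d hd
      rw [hk] at hn; cases hn
  · intro c _ hle p i _ hs ht
    rcases det_sat hP hr hle hs ht with h | h | h
    · exact h
    · omega
    · omega
  · refine prog2 hP hr (fun h => ?_) ?_
    · exact occ_of hK (k := .sd) ⟨rfl, rfl⟩
    · intro x y k hk h1 h2 h3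
      refine occ_of hK (k := k) (reg_strip hk hP h3 (Or.inl ?_) ?_)
      · show x < M
        omega
      · rw [hb]; rfl

lemma lowReg {L M : ℤ} {β : ℤ → ℤ} {τ : ℕ} (hτ : τ = 42 ∧ M = 2 * L ∨ τ = 40 ∧ M = 2 * L + 1)
    (hβ : ∀ x, (L ≤ x ∧ x < 2 * L → β x = 0) ∧ (x = 2 * L → β x = 1)) : Reg (lp L M β) τ := by
  rcases hτ with ⟨h1, h2⟩ | ⟨h1, h2⟩
  · exact Or.inr (Or.inr (Or.inr (Or.inl ⟨h1, h2, rfl, rfl, rfl, hβ⟩)))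
  · exact Or.inr (Or.inr (Or.inr (Or.inr ⟨h1, h2, rfl, rfl, rfl, hβ⟩)))

lemma bp_le {L M : ℤ} {β β' : ℤ → ℤ} {k : Ty} {x y : ℤ} (hL : 1 ≤ L) (hM : L ≤ M) 
    (hb : x < L → β' x = β x)
    (h : reg (bp L β) k x y) : reg (lp L M β') k x y := by
  cases k <;> simp only [reg, bp, lp] at h ⊢ <;> omega

lemma fa_in {i j : Ty} (hi : i = .FA ∨ i = .FAp) (hj : gl j .n = gl i .s) :
    inp i .s = true ∧ (j = .Q ∨ j = .Qp ∨ j = .R ∨ j = .M) ∧ inp j .n = true := by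
  revert i j; decide +kernel

lemma phase_low {L M : ℤ} {β β' : ℤ → ℤ} {τ : ℕ} (hL : 1 ≤ L)
    (hτ : τ = 42 ∧ M = 2 * L ∨ τ = 40 ∧ M = 2 * L + 1)
    (hβ : ∀ x, (L ≤ x ∧ x < 2 * L → β' x = 0) ∧ (x = 2 * L → β' x = 1))
    (hb : ∀ x, x < L → β' x = β x)
    (hg : Gr TS 44 (cf (kp L β)) (cf (bp L β))) (hst : Stable TS τ (cf (bp L β))) :
    PD τ (toC TS (cf (bp L β))) (toC TS (cf (lp L M β'))) := by
  have hLM : L ≤ M := by omega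
  have hK : (kp L β).Ok := kp_ok hL
  have hB : (bp L β).Ok := bp_ok hL
  have hP : (lp L M β').Ok := lp_ok hL hLM
  have hr : Reg (lp L M β') τ := lowReg hτ hβ
  refine (growth goodTS (by omega) (by omega) hst (cf_fin hP) ?_ ?_ ?_ ?_).1
  · intro q j h
    rw [cf_some hB] at h
    rw [cf_some hP]
    exact bp_le hL hLM (hb _) h
  · intro c hc hle q j d i hq hd hn hbd
    exfalso
    rcases hc.new _ _ hq with h | ⟨_, h, _⟩
    · rcases hg.new _ _ h with h' | ⟨_, h', _⟩
      · rw [cf_some hK] at h'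
        rcases in_core h' hd with ⟨rfl, hj⟩ | ⟨k, hk⟩
        · refine Le.occ hc.le ?_ hn
          rcases hj with rfl | rfl
          · exact occ_of hB (k := .FA) (by simp only [reg, bp, nb, kp] at h' ⊢; omega)
          · exact occ_of hB (k := .FAp) (by simp only [reg, bp, nb, kp] at h' ⊢; omega)
        · exact Le.occ hc.le (Le.occ hg.le (occ_of hK hk)) hn
      · obtain ⟨k, hk, _⟩ := h' d hd
        rw [hc.le _ _ hk] at hn; cases hn
    · obtain ⟨k, hk, _⟩ := h d hd
      rw [hk] at hn; cases hn
  · intro c hc hle p i hp hs ht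
    rcases det_sat hP hr hle hs ht with h | ⟨_, rfl, h⟩ | ⟨_, h1, h2⟩
    · exact h
    · exfalso
      refine Le.occ hc.le (occ_of hB (k := .DA) ?_) hp
      simp only [reg, lp, bp] at h ⊢; exact h
    · exfalso
      obtain ⟨j, hj, hj2⟩ := hs .s (by rcases h2 with rfl | rfl <;> rfl)
      obtain ⟨-, h3, h4⟩ := fa_in h2 hj2
      rcases hc.new _ _ hj with h5 | ⟨_, h5, _⟩
      · rw [cf_some hB] at h5
        simp only [lp] at h1
        simp only [nb] at h5
        rcases h3 with rfl | rfl | rfl | rfl <;> simp only [reg, bp] at h5 <;> omega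
      · obtain ⟨k, hk, _⟩ := h5 .n h4
        have : nb .n (nb .s p) = p := nb_op .s p
        rw [this, hp] at hk; cases hk
  · refine prog2 hP hr (fun h => ?_) ?_
    · exact occ_of hB (k := .sd) ⟨rfl, rfl⟩
    · intro x y k hk h1 h2 h3
      refine occ_of hB (k := k) (reg_strip hk hP h3 (Or.inl h2) ?_)
      exact (hb x h2).symm
end TA

namespace TA

lemma cut_ge {c : TC Ty} {Q : Finset (ℤ × ℤ)} {p : ℤ × ℤ} {d : Dir} (hp : p ∈ Q) (hn : nb d p ∉ Q) :
    xb TS c c p d ≤ cutT TS c Q := by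
  unfold cutT
  refine le_trans ?_ (Finset.single_le_sum (f := fun p => ∑ d, if nb d p ∈ Q then 0 else xb TS c c p d)
    (fun _ _ => Nat.zero_le _) hp)
  refine le_trans ?_ (Finset.single_le_sum (f := fun d => if nb d p ∈ Q then 0 else xb TS c c p d)
    (fun _ _ => Nat.zero_le _) (Finset.mem_univ d))
  simp [hn]

lemma cut_ge2 {c : TC Ty} {Q : Finset (ℤ × ℤ)} {p : ℤ × ℤ} {d d' : Dir} (hp : p ∈ Q)
    (hn : nb d p ∉ Q) (hn' : nb d' p ∉ Q) (hne : d ≠ d') :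
    xb TS c c p d + xb TS c c p d' ≤ cutT TS c Q := by
  unfold cutT
  refine le_trans ?_ (Finset.single_le_sum (f := fun p => ∑ d, if nb d p ∈ Q then 0 else xb TS c c p d)
    (fun _ _ => Nat.zero_le _) hp)
  have h := Finset.sum_le_sum_of_subset (f := fun d => if nb d p ∈ Q then 0 else xb TS c c p d)
    (Finset.subset_univ ({d, d'} : Finset Dir))
  rw [Finset.sum_pair hne] at h
  simpa [hn, hn'] using h

lemma cut_ge3 {c : TC Ty} {Q : Finset (ℤ × ℤ)} {p p' : ℤ × ℤ} {d d' : Dir} (hp : p ∈ Q)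
    (hp' : p' ∈ Q) (hn : nb d p ∉ Q) (hn' : nb d' p' ∉ Q) (hne : p ≠ p') :
    xb TS c c p d + xb TS c c p' d' ≤ cutT TS c Q := by
  unfold cutT
  have h := Finset.sum_le_sum_of_subset
    (f := fun p => ∑ d, if nb d p ∈ Q then 0 else xb TS c c p d)
    (s := {p, p'}) (t := Q) (by intro q hq; simp at hq; rcases hq with rfl | rfl <;> assumption)
  rw [Finset.sum_pair hne] at h
  refine le_trans (Nat.add_le_add ?_ ?_) h
  · refine le_trans ?_ (Finset.single_le_sum (f := fun d => if nb d p ∈ Q then 0 else xb TS c c p d)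
      (fun _ _ => Nat.zero_le _) (Finset.mem_univ d))
    simp [hn]
  · refine le_trans ?_ (Finset.single_le_sum
      (f := fun d => if nb d p' ∈ Q then 0 else xb TS c c p' d)
      (fun _ _ => Nat.zero_le _) (Finset.mem_univ d'))
    simp [hn']

lemma xb_val {c : TC Ty} {p : ℤ × ℤ} {d : Dir} {i j : Ty} (hi : c p = some i)
    (hj : c (nb d p) = some j) (h : gl j (op d) = gl i d) : xb TS c c p d = gl i d % 100 := by
  unfold xb ob
  rw [hi]; simp only [hj]
  exact if_pos (show gl i d = gl j (op d) from h.symm)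

section core
variable {M : ℤ} {β : ℤ → ℤ}

lemma kq (hM : 1 ≤ M) {x : ℤ} (h1 : 1 ≤ x) (h2 : x < M) :
    ∃ k, (k = .Q ∨ k = .Qp) ∧ cf (kp M β) (x, 0) = some k := by
  by_cases hb : β x = 0
  · exact ⟨.Q, Or.inl rfl, (cf_some (kp_ok hM)).2 ⟨rfl, h1, h2, hb⟩⟩
  · exact ⟨.Qp, Or.inr rfl, (cf_some (kp_ok hM)).2 ⟨rfl, h1, h2, hb⟩⟩

lemma kP (hM : 1 ≤ M) {x : ℤ} (h1 : 1 ≤ x) (h2 : x < M) :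
    cf (kp M β) (x, -1) = some .P := (cf_some (kp_ok hM)).2 ⟨rfl, h1, h2⟩

lemma kw0 (hM : 1 ≤ M) {x : ℤ} (h1 : 1 ≤ x) (h2 : x < M) :
    xb TS (cf (kp M β)) (cf (kp M β)) (x, 0) .w = 31 := by
  obtain ⟨k, hk, hk'⟩ := kq (β := β) hM h1 h2
  by_cases hx : x = 1
  · subst hx
    rw [xb_val hk' (j := .sd) ((cf_some (kp_ok hM)).2 ⟨rfl, rfl⟩)] <;>
      rcases hk with rfl | rfl <;> rfl
  · obtain ⟨j, hj, hj'⟩ := kq (β := β) hM (x := x - 1) (by omega) (by omega)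
    rw [xb_val (d := .w) hk' (j := j) hj'] <;> rcases hk with rfl | rfl <;> rcases hj with rfl | rfl <;> rfl

lemma kw1 (hM : 1 ≤ M) {x : ℤ} (h1 : 1 ≤ x) (h2 : x < M) :
    xb TS (cf (kp M β)) (cf (kp M β)) (x, -1) .w = 31 := by
  by_cases hx : x = 1
  · subst hx
    rw [xb_val (kP hM h1 h2) (j := .u0) ((cf_some (kp_ok hM)).2 ⟨rfl, rfl⟩)] <;> rfl
  · rw [xb_val (kP hM h1 h2) (d := .w) (j := .P) (kP hM (x := x - 1) (by omega) (by omega))] <;> rfl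

lemma ks (hM : 1 ≤ M) {x : ℤ} (h1 : 1 ≤ x) (h2 : x < M) :
    xb TS (cf (kp M β)) (cf (kp M β)) (x, 0) .s = 31 := by
  obtain ⟨k, hk, hk'⟩ := kq (β := β) hM h1 h2
  rw [xb_val (d := .s) hk' (j := .P) (kP hM (x := x) h1 h2)] <;> rcases hk with rfl | rfl <;> rfl

lemma kn (hM : 1 ≤ M) {x : ℤ} (h1 : 1 ≤ x) (h2 : x < M) :
    xb TS (cf (kp M β)) (cf (kp M β)) (x, -1) .n = 31 := by
  obtain ⟨k, hk, hk'⟩ := kq (β := β) hM h1 h2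
  rw [xb_val (d := .n) (kP hM h1 h2) (j := k) (by simpa [nb] using hk')] <;> rcases hk with rfl | rfl <;> rfl

lemma stable_core (hM : 1 ≤ M) : Stable TS 62 (cf (kp M β)) := by
  intro Q hne h0 hQ
  have hK := kp_ok (β := β) hM
  have key : ∀ (p : ℤ × ℤ) (d : Dir) (i j : Ty), p ∈ Q → nb d p ∉ Q → reg (kp M β) i p.1 p.2 →
      reg (kp M β) j (nb d p).1 (nb d p).2 → gl j (op d) = gl i d → gl i d % 100 = 99 →
      62 ≤ cutT TS (cf (kp M β)) Q := by
    intro p d i j h1 h2 h3 h4 h5 h6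
    have h7 := cut_ge (c := cf (kp M β)) h1 h2
    rw [xb_val ((cf_some hK).2 h3) ((cf_some hK).2 h4) h5] at h7
    omega
  by_cases c1 : ((-1, 0) : ℤ × ℤ) ∈ Q
  · exact key _ .e .t1 .sd c1 h0 ⟨rfl, rfl⟩ ⟨rfl, rfl⟩ rfl rfl
  by_cases c2 : ((-2, 0) : ℤ × ℤ) ∈ Q
  · exact key _ .e .t2 .t1 c2 c1 ⟨rfl, rfl⟩ ⟨rfl, rfl⟩ rfl rfl
  by_cases c3 : ((0, -1) : ℤ × ℤ) ∈ Q
  · exact key _ .n .u0 .sd c3 h0 ⟨rfl, rfl⟩ ⟨rfl, rfl⟩ rfl rfl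
  by_cases c4 : ((-1, -1) : ℤ × ℤ) ∈ Q
  · exact key _ .e .u1 .u0 c4 c3 ⟨rfl, rfl⟩ ⟨rfl, rfl⟩ rfl rfl
  by_cases c5 : ((-2, -1) : ℤ × ℤ) ∈ Q
  · exact key _ .e .u2 .u1 c5 c4 ⟨rfl, rfl⟩ ⟨rfl, rfl⟩ rfl rfl
  have hpos : ∀ p ∈ Q, (p.2 = 0 ∨ p.2 = -1) ∧ 1 ≤ p.1 ∧ p.1 < M := by
    rintro ⟨x, y⟩ hp
    obtain ⟨k, hk⟩ := Option.ne_none_iff_exists'.1 (hQ _ hp)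
    obtain ⟨h1, h2, h3⟩ := kreg ((cf_some hK).1 hk)
    simp only at h1 h2 h3 ⊢
    by_contra hcon
    have hx : x = 0 ∨ x = -1 ∨ x = -2 := by omega
    rcases hx with rfl | rfl | rfl <;> rcases h1 with rfl | rfl <;> contradiction
  obtain ⟨⟨x, y⟩, hp, hmin⟩ := Finset.exists_min_image Q (fun p => p.1) hne
  have hw : ∀ y', ((x - 1, y') : ℤ × ℤ) ∉ Q := by
    intro y' h
    have := hmin _ h
    simp only at this; omega
  obtain ⟨h1, h2, h3⟩ := hpos _ hp
  simp only at h1 h2 h3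
  rcases h1 with rfl | rfl
  · by_cases hb : ((x, -1) : ℤ × ℤ) ∈ Q
    · have := cut_ge3 (c := cf (kp M β)) (d := .w) (d' := .w) hp hb (hw _) (hw _) (by simp)
      rw [kw0 hM h2 h3, kw1 hM h2 h3] at this
      exact this
    · have := cut_ge2 (c := cf (kp M β)) (d := .w) (d' := .s) hp (hw _) hb (by decide)
      rw [kw0 hM h2 h3, ks hM h2 h3] at this
      exact this
  · by_cases hb : ((x, 0) : ℤ × ℤ) ∈ Q
    · have := cut_ge3 (c := cf (kp M β)) (d := .w) (d' := .w) hp hb (hw _) (hw _) (by simp)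
      rw [kw0 hM h2 h3, kw1 hM h2 h3] at this
      exact this
    · have := cut_ge2 (c := cf (kp M β)) (d := .w) (d' := .n) hp (hw _) hb (by decide)
      rw [kw1 hM h2 h3, kn hM h2 h3] at this
      exact this
end core

def occ (L M x y : ℤ) : Prop :=
  ((y = 0 ∨ y = -1) ∧ -2 ≤ x ∧ x < M) ∨ (y ≤ -2 ∧ -1 - M ≤ y ∧ -2 ≤ x ∧ x < M) ∨
  (0 ≤ x ∧ x < L ∧ 1 ≤ y ∧ y ≤ 2 * x + 3) ∨ (L ≤ x ∧ x ≤ 2 * L ∧ 1 ≤ y ∧ y ≤ 2 * L + 1 ∧ 2 * x + y ≤ 4 * L + 2)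

lemma reg_occ {L M : ℤ} {β : ℤ → ℤ} (hL : 1 ≤ L) (hM : M = 2 * L ∨ M = 2 * L + 1) {k : Ty} {x y : ℤ}
    (h : reg (lp L M β) k x y) : occ L M x y := by
  unfold occ
  cases k <;> simp only [reg, lp] at h <;> omega

def expo : Ty → Dir → Bool
  | .sd => b4 false true false false
  | .Q => b4 false true false false
  | .Qp => b4 false true false false
  | .u0 => b4 false true false false
  | .P => b4 false true false false
  | .E => b4 false true false false
  | .F => b4 false true false false
  | .D0 => b4 false true true true
  | .D => b4 false true true true
  | .H0 => b4 false false true true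
  | .H => b4 false false true true
  | .Xg => b4 false false true false
  | _ => b4 false false false false

def isA (j : Ty) : Bool := gl j .e == gl .FA .e

set_option maxHeartbeats 8000000 in
lemma nbr {L M : ℤ} {β : ℤ → ℤ} (hL : 1 ≤ L) (hM : M = 2 * L ∨ M = 2 * L + 1)
    (hβ : ∀ x, (L ≤ x ∧ x < 2 * L → β x = 0) ∧ (x = 2 * L → β x = 1)) {j : Ty} {x y : ℤ}
    (h : reg (lp L M β) j x y) (e : Dir) (hg : gl j e ≠ 0) :
    (∃ k, k ∈ pl j e ∧ reg (lp L M β) k (nb e (x, y)).1 (nb e (x, y)).2) ∨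
    (¬ occ L M (nb e (x, y)).1 (nb e (x, y)).2 ∧ expo j e = true) ∨
    (j = .J ∧ e = .e) ∨
    (e = .e ∧ isA j = true ∧ (reg (lp L M β) .X (x + 1) y ∨ reg (lp L M β) .Xg (x + 1) y)) := by
  have hb := hβ x
  clear hβ
  have iA : ∀ j, isA j = true ↔ (j = .DA0 ∨ j = .DA ∨ j = .FA ∨ j = .FAp ∨ j = .FA3) := by decide +kernel
  rw [iA]
  cases e
  all_goals
    cases j <;> first | exact absurd rfl hg | skip
  all_goals
    clear hg iA
    simp only [pl, l4, List.mem_cons, List.not_mem_nil, or_false, or_and_right, exists_or,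
        exists_eq_left, reg, nb, lp, expo, b4, Bool.false_eq_true, reduceCtorEq, and_false, false_and,
        true_and, and_true, false_or, or_true, true_or, occ] at h ⊢
  all_goals (rcases hM with rfl | rfl <;> omega)
end TA

namespace TA

lemma erosion {ι : Type} {S : Sys ι} [Fintype ι] {τ : ℕ} {Inv : TC ι → Prop} {D K : TC ι} (hI : Inv D)
    (hfin : ∀ c, Inv c → {p | c p ≠ none}.Finite) (hle : ∀ c, Inv c → Le K c)
    (hstep : ∀ c E, Inv c → MStep (tiles S) S.G τ (toC S c) E →
      ∃ c', E = toC S c' ∧ Inv c' ∧ Le c' c ∧ ∃ p, c p ≠ none ∧ c' p = none)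
    (hprog : ∀ c, Inv c → c ≠ K → ∃ E, MStep (tiles S) S.G τ (toC S c) E) :
    PhaseDet (MStep (tiles S) S.G) τ (toC S D) (toC S K) := by
  let μ : Config → ℕ := fun C => (shape C).ncard
  have dec : ∀ C E, (∃ c, C = toC S c ∧ Inv c) → MStep (tiles S) S.G τ C E →
      (∃ c, E = toC S c ∧ Inv c) ∧ μ E < μ C := by
    rintro C E ⟨c, rfl, hc⟩ hE
    obtain ⟨c', rfl, hc', hl, p, hp, hp'⟩ := hstep c E hc hE
    refine ⟨⟨c', rfl, hc'⟩, ?_⟩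
    show (shape _).ncard < (shape _).ncard
    rw [shape_toC, shape_toC]
    refine Set.ncard_lt_ncard ?_ (hfin c hc)
    rw [Set.ssubset_iff_of_subset]
    · exact ⟨p, hp, fun h => h hp'⟩
    · intro q hq
      exact fun h => hq (Le.nn hl h)
  have reach : ∀ n c, Inv c → μ (toC S c) ≤ n →
      Relation.ReflTransGen (MStep (tiles S) S.G τ) (toC S c) (toC S K) ∧ Inv K := by
    intro n
    induction n with
    | zero =>
      intro c hc hn
      by_cases hD : c = K
      · subst hD; exact ⟨Relation.ReflTransGen.refl, hc⟩
      · obtain ⟨E, h2⟩ := hprog c hc hD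
        have := (dec _ _ ⟨c, rfl, hc⟩ h2).2
        omega
    | succ n ih =>
      intro c hc hn
      by_cases hD : c = K
      · subst hD; exact ⟨Relation.ReflTransGen.refl, hc⟩
      · obtain ⟨E, h2⟩ := hprog c hc hD
        obtain ⟨⟨c', rfl, h3⟩, h4⟩ := dec _ _ ⟨c, rfl, hc⟩ h2
        obtain ⟨h4, h5⟩ := ih c' h3 (by omega)
        exact ⟨Relation.ReflTransGen.head h2 h4, h5⟩
  obtain ⟨r1, r2⟩ := reach _ D hI le_rfl
  refine ⟨no_inf _ μ ⟨D, rfl, hI⟩ dec, r1, ?_, ?_⟩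
  · intro E hE
    obtain ⟨c', rfl, hc', hl, p, hp, hp'⟩ := hstep K E r2 hE
    exact hp (Le.nn (hle _ hc') hp')
  · intro E hE hT
    obtain ⟨c, rfl, hc⟩ := rtg_inv (fun C => ∃ c, C = toC S c ∧ Inv c)
      ⟨D, rfl, hI⟩ (fun C D h h' => (dec C D h h').1) hE
    by_cases hD : c = K
    · rw [hD]
    · obtain ⟨c', h2⟩ := hprog c hc hD
      exact absurd h2 (hT _)

/-- the cluster types -/
def cl (j : Ty) : Prop := j = .t1 ∨ j = .t2 ∨ j = .u0 ∨ j = .u1 ∨ j = .u2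

lemma ist62 {j : Ty} (h : 62 ≤ ist j) : cl j ∨ j = .P := by
  unfold cl; revert j; decide +kernel

lemma float62 {r : ℤ × ℤ} {i : Ty} {a : TC Ty} (h : Gr TS 62 (single r i) a) {p : ℤ × ℤ} {j : Ty}
    (hp : a p = some j) : p = r ∨ cl j := by
  have new : ∀ p j, a p = some j → p ≠ r → Sat TS a p j ∧ (cl j ∨ j = .P) := by
    intro p j hp hr
    rcases h.new _ _ hp with h1 | ⟨_, h2, h3⟩
    · simp [single, hr] at h1
    · rw [isum_eq] at h3; exact ⟨h2, ist62 h3⟩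
  by_cases hr : p = r
  · exact Or.inl hr
  obtain ⟨h1, h2 | rfl⟩ := new p j hp hr
  · exact Or.inr h2
  exfalso
  obtain ⟨k, hk, hk2⟩ := h1 .n rfl
  obtain ⟨m, hm, hm2⟩ := h1 .w rfl
  have hk3 : k ∈ pl .P .n := (pl_iff (i := .P) (d := .n) (by decide)).1 hk2
  have hm3 : m ∈ pl .P .w := (pl_iff (i := .P) (d := .w) (by decide)).1 hm2
  simp only [pl, l4, List.mem_cons, List.not_mem_nil, or_false] at hk3 hm3
  have e1 : nb .n p = r := by
    by_contra hne
    have := (new _ _ hk hne).2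
    unfold cl at this
    rcases hk3 with rfl | rfl <;> simp at this
  have e2 : nb .w p ≠ r := by
    rw [← e1]; intro h; cases nb_inj h
  have hs := (new _ _ hm e2).1
  obtain ⟨q, hq, hq2⟩ := hs .n (by rcases hm3 with rfl | rfl <;> rfl)
  have e3 : nb .n (nb .w p) ≠ r := by
    rw [← e1]; intro h; simp [nb] at h
  have hq3 := (new _ _ hq e3).2
  have hq4 : q ∈ pl m .n := (pl_iff (by rcases hm3 with rfl | rfl <;> decide)).1 hq2
  unfold cl at hq3
  rcases hm3 with rfl | rfl <;>
    simp only [pl, l4, List.mem_cons, List.not_mem_nil, or_false] at hq4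
  · subst hq4; simp at hq3
  · rcases hq4 with rfl | rfl <;> simp at hq3

lemma core_occ {M x y : ℤ} {β : ℤ → ℤ} (hM : 1 ≤ M) (hy : y = 0 ∨ y = -1) (h1 : -2 ≤ x) (h2 : x < M) :
    cf (kp M β) (x, y) ≠ none := by
  have hK := kp_ok (β := β) hM
  by_cases hx : 1 ≤ x
  · rcases hy with rfl | rfl
    · obtain ⟨k, _, hk⟩ := kq (β := β) hM hx h2
      rw [hk]; simp
    · rw [kP hM hx h2]; simp
  · have : x = 0 ∨ x = -1 ∨ x = -2 := by omega
    rcases this with rfl | rfl | rfl <;> rcases hy with rfl | rfl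
    · exact occ_of hK (k := .sd) ⟨rfl, rfl⟩
    · exact occ_of hK (k := .u0) ⟨rfl, rfl⟩
    · exact occ_of hK (k := .t1) ⟨rfl, rfl⟩
    · exact occ_of hK (k := .u1) ⟨rfl, rfl⟩
    · exact occ_of hK (k := .t2) ⟨rfl, rfl⟩
    · exact occ_of hK (k := .u2) ⟨rfl, rfl⟩

lemma cl_pos {L M : ℤ} {β : ℤ → ℤ} (hL : 1 ≤ L) (hM : L ≤ M) {i j : Ty} (hi : cl i) {d : Dir} {x y : ℤ}
    (hj : j ∈ pl i d) (h : reg (lp L M β) j (nb d (x, y)).1 (nb d (x, y)).2) :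
    (y = 0 ∨ y = -1) ∧ -2 ≤ x ∧ x < M := by
  rcases hi with rfl | rfl | rfl | rfl | rfl <;> cases d <;>
    simp only [pl, l4, List.mem_cons, List.not_mem_nil, or_false] at hj <;>
    subst hj <;> simp only [reg, nb, lp] at h <;> omega

structure Inv (L M : ℤ) (β : ℤ → ℤ) (c : TC Ty) : Prop where
  lo : Le (cf (kp M β)) c
  hi : Le c (cf (lp L M β))
  lt : ∀ z k, cf (lp L M β) z = some k → c z = none → ∑ d, ob TS c z k d < 62

lemma t_out : ∀ t : Ty, (∑ d, if (pl t d).any (fun j => expo j (op d)) then TS.G (gl t d) else 0) < 62 := by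
  decide +kernel
lemma t_J {t : Ty} (h : t ≠ .Y) : gl .J .e ≠ gl t .w := by revert t; decide +kernel
lemma t_A {t j k : Ty} (h : isA j = true) (h' : gl j .e = gl t .w) (hk : k = .X ∨ k = .Xg) :
    TS.G (gl t .w) = 35 ∧ TS.G (gl t .s) ≤ 15 ∧ gl k .n ≠ gl t .n ∧ (gl t .e ≠ 0 → gl k .e ≠ gl t .e) := by
  revert t j k; decide +kernel

lemma ob_eq {c : TC Ty} {z : ℤ × ℤ} {t k : Ty} {d : Dir} (h : gl k d = gl t d) :
    ob TS c z k d = ob TS c z t d := by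
  unfold ob bd
  rw [show TS.gl k d = TS.gl t d from h]

section ero
variable {L M : ℤ} {β : ℤ → ℤ} (hL : 1 ≤ L) (hM : M = 2 * L ∨ M = 2 * L + 1)
    (hβ : ∀ x, (L ≤ x ∧ x < 2 * L → β x = 0) ∧ (x = 2 * L → β x = 1)) {c : TC Ty}

include hL hM hβ

lemma tile_bound (hc : Inv L M β c) {z : ℤ × ℤ} (hz : c z = none) (t : Ty) :
    ∑ d, ob TS c z t d < 62 := by
  have hD : (lp L M β).Ok := lp_ok hL (by omega)
  by_cases hY : t = .Y
  · subst hY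
    rw [sum_dir]
    have h1 : ob TS c z .Y .n ≤ 0 := ob_le
    have h2 : ob TS c z .Y .e ≤ 0 := ob_le
    have h3 : ob TS c z .Y .s ≤ 7 := ob_le
    have h4 : ob TS c z .Y .w ≤ 42 := ob_le
    omega
  have key : ∀ d, 0 < ob TS c z t d → gl t d ≠ 0 ∧
      ((∃ k, reg (lp L M β) k z.1 z.2 ∧ gl k d = gl t d) ∨
      (¬ occ L M z.1 z.2 ∧ (pl t d).any (fun j => expo j (op d)) = true) ∨
      (d = .w ∧ ∃ j k, isA j = true ∧ gl j .e = gl t .w ∧ (k = .X ∨ k = .Xg) ∧ reg (lp L M β) k z.1 z.2)) := by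
    intro d hd
    obtain ⟨j, h1, h2, h3⟩ := ob_pos' hd
    refine ⟨h3, ?_⟩
    have h4 := (cf_some hD).1 (hc.hi _ _ h1)
    have h5 := nbr hL hM hβ h4 (op d) (by rw [h2]; exact h3)
    have e : nb (op d) ((nb d z).1, (nb d z).2) = z := nb_op d z
    rw [e] at h5
    rcases h5 with ⟨k, h6, h7⟩ | ⟨h6, h7⟩ | ⟨rfl, h7⟩ | ⟨h6, h7, h8⟩
    · left
      refine ⟨k, h7, ?_⟩
      have := (pl_iff (i := j) (d := op d) (by rw [h2]; exact h3)).2 h6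
      rw [op_op] at this
      rw [this, h2]
    · right; left
      refine ⟨h6, ?_⟩
      rw [List.any_eq_true]
      exact ⟨j, (pl_iff h3).1 h2, h7⟩
    · exfalso
      have : d = .w := by rw [← op_op d, h7]; rfl
      subst this
      exact t_J hY h2
    · right; right
      have : d = .w := by rw [← op_op d, h6]; rfl
      subst this
      have e1 : (nb .w z).1 + 1 = z.1 := by simp [nb]
      have e2 : (nb .w z).2 = z.2 := rfl
      rw [e1, e2] at h8
      refine ⟨rfl, j, ?_⟩
      rcases h8 with h8 | h8
      · exact ⟨.X, h7, h2, Or.inl rfl, h8⟩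
      · exact ⟨.Xg, h7, h2, Or.inr rfl, h8⟩
  cases hDz : cf (lp L M β) z with
  | none =>
    have hn := cf_none.1 hDz
    refine lt_of_le_of_lt (Finset.sum_le_sum fun d _ => ?_) (t_out t)
    by_cases h0 : 0 < ob TS c z t d
    · obtain ⟨h1, ⟨k, h2, _⟩ | ⟨_, h2⟩ | ⟨_, _, k, _, _, _, h2⟩⟩ := key d h0
      · exact absurd h2 (hn k)
      · rw [if_pos h2]; exact ob_le
      · exact absurd h2 (hn k)
    · omega
  | some k =>
    have hk := (cf_some hD).1 hDz
    have ho : occ L M z.1 z.2 := reg_occ hL hM hk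
    have key2 : ∀ d, 0 < ob TS c z t d → gl t d ≠ 0 ∧ (gl k d = gl t d ∨
        (d = .w ∧ ∃ j, isA j = true ∧ gl j .e = gl t .w ∧ (k = .X ∨ k = .Xg))) := by
      intro d hd
      obtain ⟨h1, ⟨k', h2, h3⟩ | ⟨h2, _⟩ | ⟨h2, j, k', h3, h4, h5, h6⟩⟩ := key d hd
      · rw [reg_uniq hD h2 hk] at h3; exact ⟨h1, Or.inl h3⟩
      · exact absurd ho h2
      · rw [reg_uniq hD h6 hk] at h5; exact ⟨h1, Or.inr ⟨h2, j, h3, h4, h5⟩⟩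
    by_cases hA : ∃ j, isA j = true ∧ gl j .e = gl t .w ∧ (k = .X ∨ k = .Xg)
    · obtain ⟨j, h3, h4, h5⟩ := hA
      obtain ⟨a1, a2, a3, a4⟩ := t_A h3 h4 h5
      have b1 : ob TS c z t .n = 0 := by
        by_contra h
        obtain ⟨_, h1 | ⟨h1, _⟩⟩ := key2 .n (Nat.pos_of_ne_zero h)
        · exact a3 h1
        · cases h1
      have b2 : ob TS c z t .e = 0 := by
        by_contra h
        obtain ⟨h0, h1 | ⟨h1, _⟩⟩ := key2 .e (Nat.pos_of_ne_zero h)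
        · exact a4 h0 h1
        · cases h1
      have b3 : ob TS c z t .s ≤ _ := ob_le
      have b4 : ob TS c z t .w ≤ _ := ob_le
      rw [sum_dir]; omega
    · refine lt_of_le_of_lt (Finset.sum_le_sum fun d _ => ?_) (hc.lt z k hDz hz)
      by_cases h0 : 0 < ob TS c z t d
      · obtain ⟨_, h1 | ⟨_, h1⟩⟩ := key2 d h0
        · rw [ob_eq h1]
        · exact absurd h1 hA
      · omega

lemma ero_step (hc : Inv L M β c) {E : Config} (hE : MStep (tiles TS) TS.G 62 (toC TS c) E) :
    ∃ c', E = toC TS c' ∧ Inv L M β c' ∧ Le c' c ∧ ∃ p, c p ≠ none ∧ c' p = none := by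
  have hD : (lp L M β).Ok := lp_ok hL (by omega)
  rcases step_cases goodTS (by norm_num) (by norm_num) hE with
    ⟨a, r, i, F, rfl, ha, hd, ht⟩ | ⟨Q, ⟨q, hq⟩, h3, h4, h5, rfl⟩
  · exfalso
    have hs := sum_at_root (S := TS) (b := c) (F := F) ha.root (by
      intro p d hp
      obtain ⟨i, j, hi, hj, hb⟩ := xb_pos hp
      rcases float62 ha hi with h | h
      · exact h
      exfalso
      have h0 : gl i d ≠ 0 := by
        intro h0
        have := bd_le (S := TS) i j d
        have e : TS.G (TS.gl i d) = 0 := by show (gl i d) % 100 = 0; rw [h0]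
        omega
      have h1 := (pl_iff h0).1 (bd_pos (S := TS) hb).1
      have h2 := (cf_some hD).1 (hc.hi _ _ hj)
      obtain ⟨a1, a2, a3⟩ := cl_pos (x := p.1) (y := p.2) hL (by omega) h h1 h2
      have := Le.occ hc.lo (core_occ (by omega) a1 a2 a3)
      rcases hd p with h | h
      · exact this h
      · rw [h] at hi; cases hi)
    have hr : c r = none := by
      rcases hd r with h | h
      · exact h
      · rw [ha.root] at h; cases h
    have := tile_bound hL hM hβ hc hr i
    omega
  · have hle : Le (fun q => if q ∈ Q then none else c q) c := by
      intro p j h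
      by_cases hp : p ∈ Q
      · simp [hp] at h
      · simpa [hp] using h
    have hlo : ∀ p ∈ Q, cf (kp M β) p = none := by
      by_contra hcon
      push Not at hcon
      obtain ⟨p, hp, hp'⟩ := hcon
      classical
      have h6 := stable_core (M := M) (β := β) (by omega) (Q.filter fun p => cf (kp M β) p ≠ none)
        ⟨p, by simp [hp, hp']⟩ (fun h => h3 (Finset.mem_filter.1 h).1)
        (fun p hp => (Finset.mem_filter.1 hp).2)
      have h7 := cut_mono (S := TS) hc.lo (Finset.filter_subset (fun p => cf (kp M β) p ≠ none) Q) (by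
        intro p hp h
        by_contra hne
        exact h (Finset.mem_filter.2 ⟨hp, hne⟩))
      omega
    refine ⟨_, rfl, ⟨?_, ?_, ?_⟩, hle, q, h4 q hq, by simp [hq]⟩
    · intro p j h
      have : p ∉ Q := fun hp => by rw [hlo p hp] at h; cases h
      simp [this, hc.lo _ _ h]
    · intro p j h
      exact hc.hi _ _ (hle _ _ h)
    · intro z k hk hz
      by_cases hzQ : z ∈ Q
      · refine lt_of_le_of_lt ?_ h5
        unfold cutT
        refine le_trans ?_ (Finset.single_le_sum
          (f := fun p => ∑ d, if nb d p ∈ Q then 0 else xb TS c c p d) (fun _ _ => Nat.zero_le _) hzQ)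
        refine Finset.sum_le_sum fun d _ => ?_
        have hcz : c z = some k := by
          obtain ⟨k', hk'⟩ := Option.ne_none_iff_exists'.1 (h4 z hzQ)
          rw [hc.hi _ _ hk'] at hk; cases hk; exact hk'
        by_cases hn : nb d z ∈ Q
        · simp [ob, hn]
        · simp [ob, xb, hn, hcz]
      · refine lt_of_le_of_lt (Finset.sum_le_sum fun d _ => ob_mono hle _ _ _) (hc.lt z k hk ?_)
        simpa [hzQ] using hz
end ero
end TA

namespace TA

lemma n_bd {k : Ty} {M L x y : ℤ} {β : ℤ → ℤ} (hL : 1 ≤ L) (h : reg (lp L M β) k x y) (hy : 1 ≤ y)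
    (h1 : k ≠ .X) (h2 : k ≠ .Xg) :
    TS.G (gl k .w) + TS.G (gl k .s) < 62 ∨ (TS.G (gl k .w) < 62 ∧ ∀ j ∈ pl k .s, j = .X ∨ j = .Xg) := by
  cases k <;> first | (exfalso; simp only [reg, lp] at h; omega) | decide +kernel

lemma s_bd {k : Ty} {M L x y : ℤ} {β : ℤ → ℤ} (hL : 1 ≤ L) (h : reg (lp L M β) k x y) (hy : y ≤ -2) :
    TS.G (gl k .w) + TS.G (gl k .n) < 62 := by
  cases k <;> first | (exfalso; simp only [reg, lp] at h; omega) | decide +kernel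

lemma ob_none {c : TC Ty} {p : ℤ × ℤ} {k : Ty} {d : Dir} (h : c (nb d p) = none) : ob TS c p k d = 0 := by
  unfold ob; rw [h]

/-- choose an extremal element -/
lemma extr {c : TC Ty} (hf : {p | c p ≠ none}.Finite) (P : ℤ × ℤ → Prop) (s : ℤ)
    (h : ∃ p, c p ≠ none ∧ P p) :
    ∃ p, c p ≠ none ∧ P p ∧ ∀ q, c q ≠ none → P q →
      s * q.2 < s * p.2 ∨ (s * q.2 = s * p.2 ∧ q.1 ≤ p.1) := by
  have hf' : {p | c p ≠ none ∧ P p}.Finite := hf.subset fun p hp => hp.1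
  have hn : hf'.toFinset.Nonempty := by
    obtain ⟨p, hp⟩ := h
    exact ⟨p, by simpa using hp⟩
  obtain ⟨p, hp, hmax⟩ := Finset.exists_max_image _ (fun q => toLex (s * q.2, q.1)) hn
  simp only [Set.Finite.mem_toFinset, Set.mem_ofPred_eq] at hp hmax
  refine ⟨p, hp.1, hp.2, fun q h1 h2 => ?_⟩
  have := hmax q ⟨h1, h2⟩
  rw [Prod.Lex.toLex_le_toLex] at this
  exact this

section ero
variable {L M : ℤ} {β : ℤ → ℤ} {c : TC Ty}

lemma inv_fin (hL : 1 ≤ L) (hM : L ≤ M) (hc : Inv L M β c) : {p | c p ≠ none}.Finite :=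
  (cf_fin (lp_ok (β := β) hL hM)).subset fun _ hp => Le.occ hc.hi hp

lemma rem_one {p : ℤ × ℤ} {k : Ty} (hk : c p = some k) (hp : p ≠ (0, 0)) (h : ∑ d, ob TS c p k d < 62) :
    ∃ E, MStep (tiles TS) TS.G 62 (toC TS c) E :=
  ⟨_, rem_set {p} (by simp) (by simpa using hp.symm) (by simp [hk]) (by rw [cut_single hk]; exact h)⟩

lemma ero_prog (hL : 1 ≤ L) (hM : M = 2 * L ∨ M = 2 * L + 1) (hc : Inv L M β c)
    (hne : c ≠ cf (kp M β)) : ∃ E, MStep (tiles TS) TS.G 62 (toC TS c) E := by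
  have hLM : L ≤ M := by omega
  have hD : (lp L M β).Ok := lp_ok hL hLM
  have hK : (kp M β).Ok := kp_ok (by omega)
  have hf := inv_fin hL hLM hc
  by_cases hX : ∃ p k, c p = some k ∧ (k = .X ∨ k = .Xg)
  · obtain ⟨p, k, h1, h2⟩ := hX
    have h3 := (cf_some hD).1 (hc.hi _ _ h1)
    refine rem_one h1 ?_ ?_
    · rintro rfl
      rcases h2 with rfl | rfl <;> simp only [reg, lp] at h3 <;> omega
    · rw [sum_dir]
      have a1 : ob TS c p k .n ≤ _ := ob_le
      have a2 : ob TS c p k .e ≤ _ := ob_le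
      have a3 : ob TS c p k .s ≤ _ := ob_le
      have a4 : ob TS c p k .w ≤ _ := ob_le
      have : TS.G (gl k .n) + TS.G (gl k .e) + TS.G (gl k .s) + TS.G (gl k .w) < 62 := by
        rcases h2 with rfl | rfl <;> decide +kernel
      omega
  by_cases hN : ∃ p, c p ≠ none ∧ 1 ≤ p.2
  · obtain ⟨p, h1, h2, h3⟩ := extr hf (fun p => 1 ≤ p.2) 1 hN
    obtain ⟨k, hk⟩ := Option.ne_none_iff_exists'.1 h1
    have hr := (cf_some hD).1 (hc.hi _ _ hk)
    have e1 : c (nb .n p) = none := by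
      by_contra h
      have := h3 _ h (by simp only [nb]; omega)
      simp only [nb] at this; omega
    have e2 : c (nb .e p) = none := by
      by_contra h
      have := h3 _ h (by simp only [nb]; omega)
      simp only [nb] at this; omega
    refine rem_one hk ?_ ?_
    · rintro rfl; omega
    · rw [sum_dir, ob_none e1, ob_none e2]
      have a3 : ob TS c p k .s ≤ _ := ob_le
      have a4 : ob TS c p k .w ≤ _ := ob_le
      rcases n_bd hL hr h2 (fun h => hX ⟨p, k, hk, Or.inl h⟩) (fun h => hX ⟨p, k, hk, Or.inr h⟩) with h | ⟨h, h'⟩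
      · omega
      · have : ob TS c p k .s = 0 := by
          by_contra h0
          obtain ⟨j, j1, j2, j3⟩ := ob_pos' (Nat.pos_of_ne_zero h0)
          exact hX ⟨_, j, j1, h' j ((pl_iff j3).1 j2)⟩
        omega
  by_cases hS : ∃ p, c p ≠ none ∧ p.2 ≤ -2
  · obtain ⟨p, h1, h2, h3⟩ := extr hf (fun p => p.2 ≤ -2) (-1) hS
    obtain ⟨k, hk⟩ := Option.ne_none_iff_exists'.1 h1
    have hr := (cf_some hD).1 (hc.hi _ _ hk)
    have e1 : c (nb .s p) = none := by
      by_contra h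
      have := h3 _ h (by simp only [nb]; omega)
      simp only [nb] at this; omega
    have e2 : c (nb .e p) = none := by
      by_contra h
      have := h3 _ h (by simp only [nb]; omega)
      simp only [nb] at this; omega
    refine rem_one hk ?_ ?_
    · rintro rfl; omega
    · rw [sum_dir, ob_none e1, ob_none e2]
      have a3 : ob TS c p k .n ≤ _ := ob_le
      have a4 : ob TS c p k .w ≤ _ := ob_le
      have := s_bd hL hr h2
      omega
  exfalso
  apply hne
  refine (Le.antisymm hc.lo fun p hp => ?_).symm
  by_contra hcon
  obtain ⟨k, hk⟩ := Option.ne_none_iff_exists'.1 hcon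
  have hr := (cf_some hD).1 (hc.hi _ _ hk)
  push Not at hN hS
  have b1 := hN _ hcon
  have b2 := hS _ hcon
  have ho := reg_occ hL hM hr
  have : reg (kp M β) k p.1 p.2 := by
    refine reg_strip hr hD (by omega) (Or.inl ?_) rfl
    unfold occ at ho
    show p.1 < M
    omega
  exact cf_none.1 hp k this

lemma phase_ero (hL : 1 ≤ L) (hM : M = 2 * L ∨ M = 2 * L + 1)
    (hβ : ∀ x, (L ≤ x ∧ x < 2 * L → β x = 0) ∧ (x = 2 * L → β x = 1)) :
    PD 62 (toC TS (cf (lp L M β))) (toC TS (cf (kp M β))) := by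
  have hLM : L ≤ M := by omega
  have hD : (lp L M β).Ok := lp_ok hL hLM
  have hK : (kp M β).Ok := kp_ok (by omega)
  refine erosion (Inv := Inv L M β) ⟨?_, fun _ _ h => h, ?_⟩ (fun c hc => inv_fin hL hLM hc)
    (fun c hc => hc.lo) (fun c E hc hE => ero_step hL hM hβ hc hE) (fun c hc hne => ero_prog hL hM hc hne)
  · intro q j h
    rw [cf_some hK] at h
    rw [cf_some hD]
    obtain ⟨h1, h2, h3⟩ := kreg h
    exact reg_strip h hK h1 h3 rfl
  · intro z k h1 h2
    rw [h1] at h2; cases h2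
end ero

lemma Stable.le {τ τ' : ℕ} {c : TC Ty} (h : Stable TS τ c) (h' : τ' ≤ τ) : Stable TS τ' c :=
  fun Q a b d => h'.trans (h Q a b d)

abbrev RN := Run (MStep (tiles TS) TS.G)

lemma round {L M : ℤ} {β β' : ℤ → ℤ} {τ : ℕ} (hL : 1 ≤ L)
    (hτ : τ = 42 ∧ M = 2 * L ∨ τ = 40 ∧ M = 2 * L + 1)
    (hβ : ∀ x, (L ≤ x ∧ x < 2 * L → β' x = 0) ∧ (x = 2 * L → β' x = 1))
    (hb : ∀ x, x < L → β' x = β x) :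
    RN [44, τ, 62] (toC TS (cf (kp L β))) (toC TS (cf (kp M β'))) := by
  have s1 : Stable TS 44 (cf (kp L β)) := (stable_core hL).le (by norm_num)
  obtain ⟨p1, g1⟩ := phase_core (P := bp L β) (τ := 44) (β := β) hL (bp_ok hL)
    (Or.inr (Or.inr (Or.inl ⟨rfl, rfl, rfl, rfl, rfl⟩))) (by norm_num) rfl rfl rfl rfl s1
  have s2 : Stable TS τ (cf (bp L β)) := (s1.gr g1).le (by omega)
  exact Run.cons p1 (Run.cons (phase_low hL hτ hβ hb g1 s2)
    (Run.cons (phase_ero hL (by omega) hβ) Run.nil))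

lemma build (n : ℕ) (hn : 1 ≤ n) : ∃ l : List ℕ, ∃ β : ℤ → ℤ, l.length = 1 + 3 * Nat.log 2 n ∧
    (∀ τ ∈ l, 1 ≤ τ ∧ τ ≤ 62) ∧
    RN l (toC TS (single (0, 0) .sd)) (toC TS (cf (kp n β))) := by
  induction n using Nat.strong_induction_on with
  | _ n ih =>
    by_cases h1 : n = 1
    · subst h1
      exact ⟨[62], fun _ => 0, by simp, by simp, Run.cons phase_seed Run.nil⟩
    obtain ⟨l, β, h2, h3, h4⟩ := ih (n / 2) (by omega) (by omega)
    set L : ℤ := ((n / 2 : ℕ) : ℤ) with hLdef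
    have hL : 1 ≤ L := by omega
    let β' : ℤ → ℤ := fun x => if x < L then β x else if x < 2 * L then 0 else 1
    have hτ : ∃ τ, (τ = 42 ∧ (n : ℤ) = 2 * L ∨ τ = 40 ∧ (n : ℤ) = 2 * L + 1) := by
      rcases Nat.even_or_odd' n with ⟨m, h | h⟩
      · exact ⟨42, Or.inl ⟨rfl, by omega⟩⟩
      · exact ⟨40, Or.inr ⟨rfl, by omega⟩⟩
    obtain ⟨τ, hτ⟩ := hτ
    have hr := round (β := β) (β' := β') hL hτ
      (fun x => ⟨fun h => by simp only [β']; rw [if_neg (by omega), if_pos (by omega)],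
        fun h => by simp only [β']; rw [if_neg (by omega), if_neg (by omega)]⟩)
      (fun x h => by simp only [β']; rw [if_pos h])
    refine ⟨l ++ [44, τ, 62], β', ?_, ?_, h4.append hr⟩
    · rw [Nat.log_of_one_lt_of_le (b := 2) (n := n) (by norm_num) (by omega)]
      simp [h2]; ring
    · intro t ht
      rw [List.mem_append] at ht
      rcases ht with ht | ht
      · exact h3 t ht
      · simp only [List.mem_cons, List.not_mem_nil, or_false] at ht
        omega

lemma build2 (n : ℕ) (hn : 1 ≤ n) : ∃ l : List ℕ, ∃ β : ℤ → ℤ, l.length = 2 + 3 * Nat.log 2 n ∧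
    (∀ τ ∈ l, 1 ≤ τ ∧ τ ≤ 62) ∧
    RN l (toC TS (single (0, 0) .sd)) (toC TS (cf (fp n β))) := by
  obtain ⟨l, β, h1, h2, h3⟩ := build n hn
  have hL : 1 ≤ (n : ℤ) := by omega
  have s1 : Stable TS 46 (cf (kp n β)) := (stable_core hL).le (by norm_num)
  obtain ⟨p1, g1⟩ := phase_core (P := fp n β) (τ := 46) (β := β) hL (fp_ok hL)
    (Or.inr (Or.inl ⟨rfl, rfl, rfl, rfl, rfl⟩)) (by norm_num) rfl rfl rfl rfl s1
  refine ⟨l ++ [46], β, by simp [h1]; ring, ?_, h3.append (Run.cons p1 Run.nil)⟩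
  intro t ht
  rw [List.mem_append] at ht
  rcases ht with ht | ht
  · exact h2 t ht
  · simp at ht; omega

lemma fp_shape {M : ℤ} {β : ℤ → ℤ} (hM : 1 ≤ M) (x y : ℤ) :
    (∃ k, reg (fp M β) k x y) ↔ (-2 ≤ x ∧ x < M ∧ -1 - M ≤ y ∧ y ≤ 0) := by
  constructor
  · rintro ⟨k, h⟩
    cases k <;> simp only [reg, fp] at h <;> omega
  · intro h
    by_cases hy : y = 0 ∨ y = -1
    · have := core_occ (β := β) hM hy h.1 h.2.1
      obtain ⟨k, hk⟩ := Option.ne_none_iff_exists'.1 this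
      have hk := (cf_some (kp_ok hM)).1 hk
      exact ⟨k, reg_strip hk (kp_ok hM) hy (Or.inl h.2.1) rfl⟩
    · by_cases h1 : 0 ≤ x + y
      · exact ⟨.F, by simp only [reg, fp]; omega⟩
      by_cases h2 : x + y = -1
      · exact ⟨.E, by simp only [reg, fp]; omega⟩
      by_cases h3 : x + y = -2
      · by_cases h4 : x = 0
        · exact ⟨.D0, by simp only [reg, fp]; omega⟩
        · exact ⟨.D, by simp only [reg, fp]; omega⟩
      by_cases h5 : y = -2
      · exact ⟨.H0, by simp only [reg, fp]; omega⟩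
      · exact ⟨.H, by simp only [reg, fp]; omega⟩
end TA

namespace TA

def gl2 : Fin 4 → Dir → ℕ
  | 0 => q4 2 1 0 0
  | 1 => q4 3 0 0 1
  | 2 => q4 0 0 2 0
  | 3 => q4 0 0 3 0
def inp2 : Fin 4 → Dir → Bool
  | 0 => b4 false false false false
  | 1 => b4 false false false true
  | 2 => b4 false false true false
  | 3 => b4 false false true false
def TT : Sys (Fin 4) := ⟨gl2, fun g => if g = 0 then 0 else 1, inp2, fun _ => false⟩
def pos2 : Fin 4 → ℤ × ℤ
  | 0 => (0, 0) | 1 => (1, 0) | 2 => (0, 1) | 3 => (1, 1)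
def D2 : TC (Fin 4) := fun p =>
  if p = (0, 0) then some 0 else if p = (1, 0) then some 1 else if p = (0, 1) then some 2 else
  if p = (1, 1) then some 3 else none

lemma goodTT : Good TT 1 where
  G0 := rfl
  A1 := by decide +kernel
  A2 := by decide +kernel
  A3 := by decide +kernel
  A3e := by decide +kernel
  A3' := by decide +kernel
  A4 := by decide +kernel
  A5 := by decide +kernel

lemma D2_some {p : ℤ × ℤ} {i : Fin 4} : D2 p = some i ↔ p = pos2 i := by
  unfold D2
  fin_cases i <;> simp only [pos2] <;> split_ifs <;> simp_all

lemma nb_pos {d : Dir} {p q : ℤ × ℤ} (h : nb d p = q) : p = nb (op d) q := by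
  rw [← h, nb_op]

lemma pos_det : ∀ (i j : Fin 4) (d : Dir), inp2 i d = true → gl2 j (op d) = gl2 i d →
    nb (op d) (pos2 j) = pos2 i := by decide +kernel
lemma pos_ex : ∀ (i : Fin 4), i ≠ 0 → 1 ≤ isum TT i ∧ ∀ d, inp2 i d = true → ∃ j, nb d (pos2 i) = pos2 j ∧
    gl2 j (op d) = gl2 i d ∧ (nb d (pos2 i)).1 + (nb d (pos2 i)).2 < (pos2 i).1 + (pos2 i).2 := by
  decide +kernel

lemma phase2 : PhaseDet (MStep (tiles TT) TT.G) 1 (toC TT (single (0, 0) 0)) (toC TT D2) := by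
  have hfin : {p | D2 p ≠ none}.Finite := by
    refine (Set.finite_range pos2).subset ?_
    intro p hp
    obtain ⟨k, hk⟩ := Option.ne_none_iff_exists'.1 hp
    exact ⟨k, (D2_some.1 hk).symm⟩
  refine (growth goodTT le_rfl le_rfl ?_ hfin ?_ ?_ ?_ ?_).1
  · intro Q h1 h2 h3
    obtain ⟨p, hp⟩ := h1
    exfalso
    have := h3 p hp
    unfold single at this
    split_ifs at this with h
    · subst h; exact h2 hp
    · exact this rfl
  · intro q j h
    unfold single at h
    split_ifs at h with hq
    cases h
    rw [D2_some]; exact hq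
  · intro c hc _ q j d i hq hd hn _
    exfalso
    rcases hc.new _ _ hq with h | ⟨_, h, _⟩
    · unfold single at h
      split_ifs at h
      cases h
      revert hd; cases d <;> decide
    · obtain ⟨k, hk, _⟩ := h d hd
      rw [hk] at hn; cases hn
  · intro c _ hle p i _ hs ht
    obtain ⟨d, hd⟩ := exists_inp ht le_rfl
    obtain ⟨j, h1, h2⟩ := hs d hd
    rw [D2_some, nb_pos (D2_some.1 (hle _ _ h1))]
    exact pos_det i j d hd h2
  · refine prog_of_rank (fun p => p.1 + p.2) hfin ?_
    intro p i h h0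
    rw [D2_some] at h
    subst h
    have hi : i ≠ 0 := by rintro rfl; simp [single, pos2] at h0
    obtain ⟨h1, h2⟩ := pos_ex i hi
    refine ⟨h1, fun d hd => ?_⟩
    obtain ⟨j, h3, h4, h5⟩ := h2 d hd
    exact ⟨j, D2_some.2 h3, h4, Or.inr h5⟩

lemma seed_eq {ι : Type} (S : Sys ι) (i : ι) : seedConfig (tl S i) = toC S (single (0, 0) i) := by
  funext p
  unfold seedConfig toC single
  split_ifs <;> rfl
end TA

/-- There are constants `c₁, c₂ > 0` and `R ∈ ℕ` such that every `n ≥ 1`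
admits a multiple temperature tile system with tile complexity at most `c₁`, temperature
range at most `R`, and temperature complexity at most `c₂ · (log₂ n + 1)` that uniquely
assembles the `n × n` square under the multiple tile model. -/
theorem stmt5 :
    ∃ (c₁ c₂ : ℝ) (R : ℕ), 0 < c₁ ∧ 0 < c₂ ∧
      ∀ n : ℕ, 1 ≤ n →
        ∃ (T : Finset Tile) (s : Tile) (G : Glue → ℕ) (τs : List ℕ),
          s ∈ T ∧ G 0 = 0 ∧ (∀ τ ∈ τs, 1 ≤ τ ∧ τ ≤ R) ∧
          (T.card : ℝ) ≤ c₁ ∧ (τs.length : ℝ) ≤ c₂ * (Real.logb 2 n + 1) ∧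
          UniquelyAssembles (MStep T G) s τs (square n) := by
  refine ⟨31, 3, 62, by norm_num, by norm_num, fun n hn => ?_⟩
  have hlog : ∀ m : ℕ, 1 ≤ m → 0 ≤ Real.logb 2 (m : ℝ) := fun m hm =>
    Real.logb_nonneg (by norm_num) (by exact_mod_cast hm)
  have hl0 := hlog n hn
  by_cases h1 : n = 1
  · refine ⟨{⟨0, 0, 0, 0⟩}, ⟨0, 0, 0, 0⟩, fun _ => 0, [], by simp, rfl, by simp, by simp, ?_, ?_⟩
    · simp only [List.length_nil, Nat.cast_zero]; linarith
    · refine ⟨_, TA.Run.nil.all, (0, 0), ?_⟩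
      subst h1
      ext ⟨x, y⟩
      simp only [shape, seedConfig, translateSet, square, Set.mem_ofPred_eq, Set.mem_image, Prod.exists,
        Prod.mk_add_mk, add_zero, Prod.mk.injEq]
      constructor
      · intro h
        split_ifs at h with h'
        · exact ⟨x, y, by push_cast; omega, rfl, rfl⟩
        · exact absurd rfl h
      · rintro ⟨a, b, h, rfl, rfl⟩
        push_cast at h
        rw [if_pos (by omega)]; simp
  by_cases h2 : n = 2
  · refine ⟨TA.tiles TA.TT, TA.tl TA.TT 0, TA.TT.G, [1], by simp [TA.tiles], rfl, by simp, ?_, ?_, ?_⟩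
    · have : (TA.tiles TA.TT).card ≤ 31 := Finset.card_image_le.trans (by decide)
      exact_mod_cast this
    · simp only [List.length_singleton, Nat.cast_one]; linarith
    · refine ⟨TA.toC TA.TT TA.D2, ?_, (0, 0), ?_⟩
      · unfold UniquelyProduces
        rw [TA.seed_eq]
        exact (TA.Run.cons TA.phase2 TA.Run.nil).all
      · subst h2
        rw [TA.shape_toC]
        ext ⟨x, y⟩
        simp only [translateSet, square, Set.mem_ofPred_eq, Set.mem_image, Prod.exists,
          Prod.mk_add_mk, add_zero, Prod.mk.injEq]
        constructor
        · intro h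
          obtain ⟨k, hk⟩ := Option.ne_none_iff_exists'.1 h
          have hk := TA.D2_some.1 hk
          refine ⟨x, y, ?_, rfl, rfl⟩
          push_cast
          fin_cases k <;> simp [TA.pos2] at hk <;> omega
        · rintro ⟨a, b, h, rfl, rfl⟩
          push_cast at h
          have e : (a = 0 ∨ a = 1) ∧ (b = 0 ∨ b = 1) := by omega
          obtain ⟨rfl | rfl, rfl | rfl⟩ := e <;> decide
  obtain ⟨l, β, b1, b2, b3⟩ := TA.build2 (n - 2) (by omega)
  have hL : (1 : ℤ) ≤ ((n - 2 : ℕ) : ℤ) := by omega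
  refine ⟨TA.tiles TA.TS, TA.tl TA.TS .sd, TA.TS.G, l, by simp [TA.tiles], rfl, b2, ?_, ?_, ?_⟩
  · have : (TA.tiles TA.TS).card ≤ 31 := Finset.card_image_le.trans (by decide)
    exact_mod_cast this
  · have e1 : Nat.log 2 (n - 2) ≤ Nat.log 2 n := Nat.log_mono_right (by omega)
    have e2 : ((Nat.log 2 n : ℕ) : ℝ) ≤ Real.logb 2 (n : ℝ) := by
      exact_mod_cast Real.natLog_le_logb n 2
    have e3 : ((Nat.log 2 (n - 2) : ℕ) : ℝ) ≤ (Nat.log 2 n : ℕ) := by exact_mod_cast e1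
    rw [b1]; push_cast; linarith
  · refine ⟨TA.toC TA.TS (TA.cf (TA.fp (n - 2 : ℕ) β)), ?_, (-2, 1 - (n : ℤ)), ?_⟩
    · unfold UniquelyProduces
      rw [TA.seed_eq]
      exact b3.all
    · rw [TA.shape_toC]
      ext ⟨x, y⟩
      simp only [translateSet, square, Set.mem_ofPred_eq, Set.mem_image, Prod.exists,
        Prod.mk_add_mk, Prod.mk.injEq]
      have e := TA.fp_shape (β := β) hL x y
      have e' : TA.cf (TA.fp (n - 2 : ℕ) β) (x, y) ≠ none ↔ ∃ k, TA.reg (TA.fp (n - 2 : ℕ) β) k x y := by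
        rw [ne_eq, TA.cf_none]; push Not; rfl
      rw [e', e]
      constructor
      · intro h
        exact ⟨x + 2, y - (1 - n), by omega, by omega, by omega⟩
      · rintro ⟨a, b, h, rfl, rfl⟩
        omega
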